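/- arXiv:1205.6729 — 2 statements merged into one kernel-verified Lean document; each statement's English description precedes it below -/
import Mathlib

section
/- Let X and Y be locally compact, locally-P Tychonoff spaces not having P, where P is either pseudocompactness or a closed hereditary Mrówka topological property preserved under finite closed sums of subspaces. Then the following are equivalent: (1) the subspaces λ_P X\X of βX and λ_P Y\Y of βY are homeomorphic; (2) (E_P(X), ≤) and (E_P(Y), ≤) are order-isomorphic; (3) (E^C_P(X), ≤) and (E^C_P(Y), ≤) are order-isomorphic; (4) (E^K_P(X), ≤) and (E^K_P(Y), ≤) are order-isomorphic, provided that X and Y are moreover strongly zero-dimensional. -/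
open Set Topology Filter

universe u

/-- A one-point Tychonoff extension of `X`: a Tychonoff space containing (a homeomorphic copy
of) `X` as a dense subspace whose complement is a single point `pt`. -/
structure OnePointExt (X : Type u) [TopologicalSpace X] : Type (u + 1) where
  carrier : Type u
  top : TopologicalSpace carrier
  t35 : @T35Space carrier top
  ι : X → carrier
  emb : @Topology.IsEmbedding X carrier _ top ι
  pt : carrier
  range_eq : Set.range ι = {pt}ᶜ
  dense : @DenseRange carrier top X ι

attribute [instance] OnePointExt.top OnePointExt.t35

variable {X : Type u} [TopologicalSpace X]

/-- The partial order on one-point extensions: `Y₁ ≤ Y₂` iff there is a continuous map from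
`Y₂` into `Y₁` fixing `X` pointwise. -/
def OnePointExt.le (Y1 Y2 : OnePointExt X) : Prop :=
  ∃ f : Y2.carrier → Y1.carrier, Continuous f ∧ ∀ x, f (Y2.ι x) = Y1.ι x

/-- Equivalence of extensions: a homeomorphism fixing `X` pointwise. -/
def OnePointExt.equiv (Y1 Y2 : OnePointExt X) : Prop :=
  ∃ h : Y1.carrier ≃ₜ Y2.carrier, ∀ x, h (Y1.ι x) = Y2.ι x

/-- `τ_Y : βX → βY`, the unique continuous extension of `id_X`. -/
noncomputable def OnePointExt.tau (Y : OnePointExt X) : StoneCech X → StoneCech Y.carrier :=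
  stoneCechExtend (continuous_stoneCechUnit.comp Y.emb.continuous)

/-- `Θ_X(Y) = τ_Y⁻¹(Y \ X)`, a subset of `βX`. -/
noncomputable def OnePointExt.theta (Y : OnePointExt X) : Set (StoneCech X) :=
  Y.tau ⁻¹' {stoneCechUnit Y.pt}

/-- A zero-set: `f⁻¹(0)` for a continuous `f : Z → [0,1]`. -/
def IsZeroSet {Z : Type u} [TopologicalSpace Z] (A : Set Z) : Prop :=
  ∃ f : Z → unitInterval, Continuous f ∧ A = f ⁻¹' {0}

/-- A cozero-set: a complement of a zero-set. -/
def IsCozeroSet {Z : Type u} [TopologicalSpace Z] (A : Set Z) : Prop :=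
  ∃ f : Z → unitInterval, Continuous f ∧ A = (f ⁻¹' {0})ᶜ

/-- `λ_P X = ⋃ { int_{βX} cl_{βX} C : C a cozero-set of X whose closure in X has P }`. -/
def lambdaP (P : (Z : Type u) → [TopologicalSpace Z] → Prop) (X : Type u)
    [TopologicalSpace X] : Set (StoneCech X) :=
  ⋃ C ∈ {C : Set X | IsCozeroSet C ∧ P (closure C)},
    interior (closure (stoneCechUnit '' C))

/-- A pseudocompact space: every continuous real-valued function is bounded. -/
def Pseudocompact (Z : Type u) [TopologicalSpace Z] : Prop :=
  ∀ f : Z → ℝ, Continuous f → ∃ M, ∀ z, |f z| ≤ M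

/-- `P` is a topological property: it is invariant under homeomorphisms. -/
def TopProperty (P : (Z : Type u) → [TopologicalSpace Z] → Prop) : Prop :=
  ∀ (Z W : Type u) [TopologicalSpace Z] [TopologicalSpace W], Z ≃ₜ W → P Z → P W

/-- `P` is closed hereditary: closed subspaces of a space with `P` have `P`. -/
def ClosedHereditary (P : (Z : Type u) → [TopologicalSpace Z] → Prop) : Prop :=
  ∀ (Z : Type u) [TopologicalSpace Z], P Z → ∀ F : Set Z, IsClosed F → P F

/-- `P` is preserved under finite closed sums of subspaces. -/
def FiniteClosedSums (P : (Z : Type u) → [TopologicalSpace Z] → Prop) : Prop :=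
  ∀ (Z : Type u) [TopologicalSpace Z] [T2Space Z] (n : ℕ) (F : Fin n → Set Z),
    (∀ i, IsClosed (F i)) → (∀ i, P (F i)) → (⋃ i, F i) = univ → P Z

/-- `P` is preserved under locally finite closed sums of subspaces. -/
def LocallyFiniteClosedSums (P : (Z : Type u) → [TopologicalSpace Z] → Prop) : Prop :=
  ∀ (Z : Type u) [TopologicalSpace Z] [T2Space Z] (ι : Type u) (F : ι → Set Z),
    LocallyFinite F → (∀ i, IsClosed (F i)) → (∀ i, P (F i)) → (⋃ i, F i) = univ → P Z

/-- `P` is preserved under countable closed sums of subspaces. -/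
def CountableClosedSums (P : (Z : Type u) → [TopologicalSpace Z] → Prop) : Prop :=
  ∀ (Z : Type u) [TopologicalSpace Z] [T2Space Z] (F : ℕ → Set Z),
    (∀ i, IsClosed (F i)) → (∀ i, P (F i)) → (⋃ i, F i) = univ → P Z

/-- Mrówka's condition (W): if a Tychonoff space `T` has a point `p` with an open base `B` at
`p` such that `T \ b` has `P` for each `b ∈ B`, then `T` has `P`. -/
def MrowkaW (P : (Z : Type u) → [TopologicalSpace Z] → Prop) : Prop :=
  ∀ (T : Type u) [TopologicalSpace T] [T35Space T] (p : T) (B : Set (Set T)),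
    (∀ b ∈ B, IsOpen b ∧ p ∈ b) →
    (∀ V : Set T, IsOpen V → p ∈ V → ∃ b ∈ B, b ⊆ V) →
    (∀ b ∈ B, P (↥(bᶜ))) → P T

/-- `X` is locally-P: every point has an open neighborhood whose closure has `P`. -/
def LocallyP (P : (Z : Type u) → [TopologicalSpace Z] → Prop)
    (X : Type u) [TopologicalSpace X] : Prop :=
  ∀ x : X, ∃ U : Set X, IsOpen U ∧ x ∈ U ∧ P (closure U)

/-- `P` coincides with pseudocompactness. -/
def IsPseudocompactness (P : (Z : Type u) → [TopologicalSpace Z] → Prop) : Prop :=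
  ∀ (Z : Type u) [TopologicalSpace Z], P Z ↔ Pseudocompact Z

/-- A `P`-far one-point extension: for every zero-set `Z` of `X` contained in a cozero-set `C`
of `X` whose closure has `P`, the closure of `Z` in the extension misses the remainder. -/
def OnePointExt.PFar (P : (Z : Type u) → [TopologicalSpace Z] → Prop)
    (Y : OnePointExt X) : Prop :=
  ∀ Z C : Set X, IsZeroSet Z → IsCozeroSet C → P (closure C) → Z ⊆ C →
    Y.pt ∉ closure (Y.ι '' Z)

/-- Čech-complete: `Z` is a Gδ-set in `βZ`. -/
def CechComplete (Z : Type u) [TopologicalSpace Z] : Prop :=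
  IsGδ (Set.range (stoneCechUnit : Z → StoneCech Z))

/-- The extension is first countable at the added point. -/
def OnePointExt.FirstCountableAtPt (Y : OnePointExt X) : Prop :=
  (𝓝 Y.pt).IsCountablyGenerated

/-- Strong zero-dimensionality: `βX` has an open base of clopen sets. -/
def StronglyZeroDimensional (X : Type u) [TopologicalSpace X] : Prop :=
  ∀ U : Set (StoneCech X), IsOpen U → ∀ x ∈ U,
    ∃ V : Set (StoneCech X), IsClopen V ∧ x ∈ V ∧ V ⊆ U

/-- `Δ` is an order-isomorphism from the subset `A` of one-point extensions of `X` (with the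
order `≤`) onto the subset `B` of one-point extensions of `Y`, where extensions are regarded
up to the equivalence `OnePointExt.equiv`: `Δ` maps `A` into `B`, reflects and preserves `≤`
on `A`, and every member of `B` is equivalent to the image of a member of `A`. -/
def RestrictedOrderIso {X Y : Type u} [TopologicalSpace X] [TopologicalSpace Y]
    (A : Set (OnePointExt X)) (B : Set (OnePointExt Y))
    (Δ : OnePointExt X → OnePointExt Y) : Prop :=
  (∀ T ∈ A, Δ T ∈ B) ∧
  (∀ T1 ∈ A, ∀ T2 ∈ A, (T1.le T2 ↔ (Δ T1).le (Δ T2))) ∧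
  (∀ S ∈ B, ∃ T ∈ A, (Δ T).equiv S)


open TopologicalSpace in
theorem coatom_key {L M : Type*} [TopologicalSpace L] [TopologicalSpace M] [T1Space L] [T1Space M]
    (e : Opens L ≃o Opens M) (x : L) : ∃ y : M, ∀ O : Opens L, x ∈ O ↔ y ∈ e O := by
  have h : IsCoatom (e (({x} : Closeds L).compl)) :=
    (e.isCoatom_iff _).2 (Opens.isCoatom_iff.2 ⟨x, rfl⟩)
  obtain ⟨y, hy⟩ := Opens.isCoatom_iff.1 h
  refine ⟨y, fun O => ?_⟩
  have h1 : x ∈ O ↔ ¬ O ≤ ({x} : Closeds L).compl := by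
    constructor
    · intro hx hle
      exact (hle hx) rfl
    · intro h; by_contra hx
      exact h fun z hz hzx => hx (by
        have : z = x := hzx
        exact this ▸ hz)
  have h2 : y ∈ e O ↔ ¬ e O ≤ ({y} : Closeds M).compl := by
    constructor
    · intro hx hle
      exact (hle hx) rfl
    · intro h; by_contra hx
      exact h fun z hz hzx => hx (by
        have : z = y := hzx
        exact this ▸ hz)
  rw [h1, h2, ← hy, e.le_iff_le]

open TopologicalSpace in
/-- An order isomorphism of open-set lattices of T1 spaces yields a homeomorphism. -/
theorem homeo_of_opens_iso {L M : Type*} [TopologicalSpace L] [TopologicalSpace M]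
    [T1Space L] [T1Space M] (e : Opens L ≃o Opens M) : Nonempty (L ≃ₜ M) := by
  have key2 : ∀ (x y : M), (∀ O : Opens M, x ∈ O ↔ y ∈ O) → x = y := by
    intro x y h
    by_contra hne
    exact ((h ⟨{y}ᶜ, isOpen_compl_singleton⟩).1 hne) rfl
  have key3 : ∀ (x y : L), (∀ O : Opens L, x ∈ O ↔ y ∈ O) → x = y := by
    intro x y h
    by_contra hne
    exact ((h ⟨{y}ᶜ, isOpen_compl_singleton⟩).1 hne) rfl
  choose f hf using coatom_key e
  choose g hg using coatom_key e.symm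
  refine ⟨⟨⟨f, g, ?_, ?_⟩, ?_, ?_⟩⟩
  · intro x
    apply key3
    intro O
    have := hg (f x) (e O)
    rw [e.symm_apply_apply] at this
    rw [← this, ← hf]
  · intro x
    apply key2
    intro O
    have := hf (g x) (e.symm O)
    rw [e.apply_symm_apply] at this
    rw [← this, ← hg]
  · refine continuous_def.2 fun s hs => ?_
    have : f ⁻¹' s = (e.symm ⟨s, hs⟩ : Opens L) := by
      ext x
      have := hf x (e.symm ⟨s, hs⟩)
      rw [e.apply_symm_apply] at this
      exact this.symm
    change IsOpen (f ⁻¹' s)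
    rw [this]; exact Opens.isOpen _
  · refine continuous_def.2 fun s hs => ?_
    have : g ⁻¹' s = (e ⟨s, hs⟩ : Opens M) := by
      ext x
      have := hg x (e ⟨s, hs⟩)
      rw [e.symm_apply_apply] at this
      exact this.symm
    change IsOpen (g ⁻¹' s)
    rw [this]; exact Opens.isOpen _

/-- A base `Q` of opens with a `compactly below`-type relation `R`. -/
structure GoodBase (L : Type*) [TopologicalSpace L] (Q : Set (TopologicalSpace.Opens L))
    (R : Q → Q → Prop) : Prop where
  bot_mem : ⊥ ∈ Q
  sup_mem : ∀ U ∈ Q, ∀ V ∈ Q, U ⊔ V ∈ Q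
  base : ∀ (O : TopologicalSpace.Opens L), ∀ x ∈ O, ∃ U ∈ Q, x ∈ U ∧ U ≤ O
  cpt : ∀ U V : Q, R U V → ∃ K : Set L, IsCompact K ∧ ((U : TopologicalSpace.Opens L) : Set L) ⊆ K
    ∧ K ⊆ ((V : TopologicalSpace.Opens L) : Set L)
  cover : ∀ V : Q, ∀ x ∈ (V : TopologicalSpace.Opens L), ∃ W : Q, R W V ∧
    x ∈ (W : TopologicalSpace.Opens L)

open TopologicalSpace in
theorem opens_iso_aux {L M : Type*} [TopologicalSpace L] [TopologicalSpace M]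
    {Q : Set (Opens L)} {Q' : Set (Opens M)} {R : Q → Q → Prop} {R' : Q' → Q' → Prop}
    (hQ : GoodBase L Q R) (hQ' : GoodBase M Q' R') (e : Q ≃o Q')
    (he : ∀ U V, R U V → R' (e U) (e V)) (O : Opens L) :
    sSup {W : Opens L | ∃ V : Q', (V : Opens M) ≤ sSup {N : Opens M | ∃ U : Q, U.1 ≤ O ∧ N = e U} ∧
      W = e.symm V} = O := by
  apply le_antisymm
  · apply sSup_le
    rintro W ⟨V, hV, rfl⟩
    intro x hx
    obtain ⟨W, hW, hxW⟩ := hQ.cover (e.symm V) x hx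
    have h1 := he _ _ hW
    rw [e.apply_symm_apply] at h1
    obtain ⟨K, hK, hWK, hKV⟩ := hQ'.cpt _ _ h1
    let ι := {U : Q // U.1 ≤ O}
    have : Nonempty ι := ⟨⟨⟨⊥, hQ.bot_mem⟩, bot_le⟩⟩
    have hcov : K ⊆ ⋃ i : ι, ((e i.1).1 : Set M) := by
      intro y hy
      have := hV (hKV hy)
      obtain ⟨N, ⟨U, hU, rfl⟩, hyN⟩ := Opens.mem_sSup.1 this
      exact mem_iUnion.2 ⟨⟨U, hU⟩, hyN⟩
    have hdir : Directed (· ⊆ ·) fun i : ι => ((e i.1).1 : Set M) := by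
      rintro ⟨U1, h1⟩ ⟨U2, h2⟩
      refine ⟨⟨⟨U1.1 ⊔ U2.1, hQ.sup_mem _ U1.2 _ U2.2⟩, sup_le h1 h2⟩, ?_, ?_⟩
      · have : e U1 ≤ e ⟨U1.1 ⊔ U2.1, hQ.sup_mem _ U1.2 _ U2.2⟩ :=
          e.monotone (show U1.1 ≤ U1.1 ⊔ U2.1 from le_sup_left)
        exact this
      · have : e U2 ≤ e ⟨U1.1 ⊔ U2.1, hQ.sup_mem _ U1.2 _ U2.2⟩ :=
          e.monotone (show U2.1 ≤ U1.1 ⊔ U2.1 from le_sup_right)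
        exact this
    obtain ⟨⟨U, hU⟩, hKU⟩ := hK.elim_directed_cover _ (fun i : ι => (e i.1).1.isOpen) hcov hdir
    have h2 : e W ≤ e U := hWK.trans hKU
    rw [e.le_iff_le] at h2
    exact hU (h2 hxW)
  · intro x hx
    obtain ⟨U, hU, hxU, hUO⟩ := hQ.base O x hx
    refine Opens.mem_sSup.2 ⟨U, ⟨e ⟨U, hU⟩, ?_, ?_⟩, hxU⟩
    · exact le_sSup ⟨⟨U, hU⟩, hUO, rfl⟩
    · simp

open TopologicalSpace in
theorem opens_iso_of_base {L M : Type*} [TopologicalSpace L] [TopologicalSpace M]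
    {Q : Set (Opens L)} {Q' : Set (Opens M)} {R : Q → Q → Prop} {R' : Q' → Q' → Prop}
    (hQ : GoodBase L Q R) (hQ' : GoodBase M Q' R') (e : Q ≃o Q')
    (he : ∀ U V, R U V ↔ R' (e U) (e V)) : Nonempty (Opens L ≃o Opens M) := by
  let f : Opens L → Opens M := fun O => sSup {N : Opens M | ∃ U : Q, U.1 ≤ O ∧ N = e U}
  let g : Opens M → Opens L := fun O => sSup {N : Opens L | ∃ U : Q', U.1 ≤ O ∧ N = e.symm U}
  have hf : Monotone f := fun O O' h =>
    sSup_le_sSup fun N ⟨U, hU, hN⟩ => ⟨U, hU.trans h, hN⟩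
  have hg : Monotone g := fun O O' h =>
    sSup_le_sSup fun N ⟨U, hU, hN⟩ => ⟨U, hU.trans h, hN⟩
  have hgf : ∀ O, g (f O) = O := fun O => opens_iso_aux hQ hQ' e (fun U V => (he U V).1) O
  have hfg : ∀ O, f (g O) = O := fun O =>
    opens_iso_aux hQ' hQ e.symm (fun U V h => by rw [he]; simpa using h) O
  exact ⟨{ toFun := f, invFun := g, left_inv := hgf, right_inv := hfg
           map_rel_iff' := fun {a b} => ⟨fun h => by
              have := hg h
              simpa [hgf] using this, fun h => hf h⟩ }⟩

open TopologicalSpace in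
/-- sigma-compact opens -/
def SigmaOpens (L : Type*) [TopologicalSpace L] : Set (Opens L) :=
  {O | IsSigmaCompact (O : Set L)}

open TopologicalSpace in
/-- compact opens -/
def CompOpens (L : Type*) [TopologicalSpace L] : Set (Opens L) :=
  {O | IsCompact (O : Set L)}

/-- order-theoretic countable way-below relation -/
def CWayBelow {α : Type*} [Preorder α] (U V : α) : Prop :=
  ∀ (s : ℕ → α) (S : α), IsLUB (range s) S → V ≤ S → ∃ n, ∀ Z, (∀ i ≤ n, s i ≤ Z) → U ≤ Z

theorem CWayBelow.map {α β : Type*} [Preorder α] [Preorder β] (e : α ≃o β) {U V : α}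
    (h : CWayBelow U V) : CWayBelow (e U) (e V) := by
  intro s S hS hV
  obtain ⟨n, hn⟩ := h (fun n => e.symm (s n)) (e.symm S) (by
    have : range (fun n => e.symm (s n)) = e.symm '' range s := by
      rw [← range_comp]; rfl
    rw [this]
    exact e.symm.isLUB_image'.2 hS) (by rwa [e.le_symm_apply])
  refine ⟨n, fun Z hZ => ?_⟩
  have := hn (e.symm Z) (fun i hi => e.symm.monotone (hZ i hi))
  rwa [e.le_symm_apply] at this

theorem cWayBelow_iff {α β : Type*} [Preorder α] [Preorder β] (e : α ≃o β) (U V : α) :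
    CWayBelow U V ↔ CWayBelow (e U) (e V) :=
  ⟨fun h => h.map e, fun h => by simpa using h.map e.symm⟩

theorem sigma_between {L : Type*} [TopologicalSpace L] [T2Space L] [LocallyCompactSpace L]
    {K V : Set L} (hK : IsCompact K) (hV : IsOpen V) (hKV : K ⊆ V) :
    ∃ W K' : Set L, IsOpen W ∧ IsSigmaCompact W ∧ IsCompact K' ∧ K ⊆ W ∧ W ⊆ K' ∧ K' ⊆ V := by
  obtain ⟨V', hV'o, hKV', hV'V, hV'c⟩ := exists_open_between_and_isCompact_closure hK hV hKV
  obtain ⟨f, hf1, hf0, -⟩ := exists_continuous_zero_one_of_isCompact hK hV'o.isClosed_compl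
    (disjoint_compl_right_iff_subset.2 hKV')
  refine ⟨{x | f x < 1 / 2}, closure V', isOpen_lt f.continuous continuous_const, ?_, hV'c, ?_, ?_,
    hV'V⟩
  · refine ⟨fun n => {x | f x ≤ 1 / 2 - 1 / (n + 1)}, fun n => ?_, ?_⟩
    · refine hV'c.of_isClosed_subset (isClosed_le f.continuous continuous_const) ?_
      intro x hx
      apply subset_closure
      by_contra hxV
      have h1 : f x = 1 := hf0 hxV
      have h2 : f x ≤ 1 / 2 - 1 / ((n : ℝ) + 1) := hx
      have h3 : 0 < 1 / ((n : ℝ) + 1) := by positivity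
      linarith
    · ext x
      simp only [mem_iUnion, mem_ofPred_eq]
      constructor
      · rintro ⟨n, hn⟩
        have h3 : 0 < 1 / ((n : ℝ) + 1) := by positivity
        linarith
      · intro h
        obtain ⟨n, hn⟩ := exists_nat_one_div_lt (sub_pos.2 h)
        exact ⟨n, by linarith⟩
  · intro x hx
    have : f x = 0 := hf1 hx
    simp [this]
  · intro x hx
    apply subset_closure
    by_contra hxV
    have h1 : f x = 1 := hf0 hxV
    have h2 : f x < 1 / 2 := hx
    linarith

theorem IsSigmaCompact.my_union {L : Type*} [TopologicalSpace L] {U V : Set L}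
    (hU : IsSigmaCompact U) (hV : IsSigmaCompact V) : IsSigmaCompact (U ∪ V) := by
  rw [union_eq_iUnion]
  exact isSigmaCompact_iUnion _ (by rintro (_ | _) <;> assumption)

open TopologicalSpace in
theorem goodBase_sigma (L : Type*) [TopologicalSpace L] [T2Space L] [LocallyCompactSpace L] :
    GoodBase L (SigmaOpens L) CWayBelow where
  bot_mem := by
    change IsSigmaCompact (∅ : Set L)
    exact isSigmaCompact_empty
  sup_mem U hU V hV := by
    change IsSigmaCompact ((U : Set L) ∪ V)
    exact IsSigmaCompact.my_union hU hV
  base O x hx := by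
    obtain ⟨W, K, hW, hWs, -, hxW, hWK, hKO⟩ := sigma_between (isCompact_singleton (x := x))
      O.isOpen (singleton_subset_iff.2 hx)
    exact ⟨⟨W, hW⟩, hWs, hxW rfl, hWK.trans hKO⟩
  cpt U V h := by
    obtain ⟨K, hK, hKV⟩ := V.2
    have hsub : ∀ n, K n ⊆ (V.1 : Set L) := fun n => by
      rw [← hKV]; exact subset_iUnion K n
    choose W K' hWo hWs hK' hKW hWK' hK'V using fun n => sigma_between (hK n) V.1.isOpen (hsub n)
    obtain ⟨n, hn⟩ := h (fun n => ⟨⟨W n, hWo n⟩, hWs n⟩) V (by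
      constructor
      · rintro _ ⟨n, rfl⟩
        exact (hWK' n).trans (hK'V n)
      · intro S hS
        change (V.1 : Set L) ⊆ S.1
        rw [← hKV]
        refine iUnion_subset fun n => (hKW n).trans ?_
        exact hS ⟨n, rfl⟩) le_rfl
    refine ⟨⋃ i ∈ Finset.range (n + 1), K' i, (Finset.range (n+1)).isCompact_biUnion
      fun i _ => hK' i, ?_, iUnion₂_subset fun i _ => hK'V i⟩
    have := hn ⟨⟨⋃ i ∈ Finset.range (n + 1), W i, isOpen_biUnion fun i _ => hWo i⟩, by
      change IsSigmaCompact (⋃ i ∈ Finset.range (n + 1), W i)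
      exact isSigmaCompact_biUnion (Finset.range (n+1)).countable_toSet fun i _ => hWs i⟩ (by
        intro i hi
        change W i ⊆ _
        exact subset_biUnion_of_mem (u := W) (by simpa using Nat.lt_succ_of_le hi))
    refine Subset.trans this ?_
    exact iUnion₂_mono fun i _ => hWK' i
  cover V x hx := by
    obtain ⟨W, K, hW, hWs, hK, hxW, hWK, hKO⟩ := sigma_between (isCompact_singleton (x := x))
      V.1.isOpen (singleton_subset_iff.2 hx)
    refine ⟨⟨⟨W, hW⟩, hWs⟩, ?_, hxW rfl⟩
    intro s S hS hVS
    have hSU : S.1.1 ⊆ ⋃ n, ((s n).1 : Set L) := by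
      have : S ≤ ⟨⟨⋃ n, ((s n).1 : Set L), isOpen_iUnion fun n => (s n).1.isOpen⟩,
          isSigmaCompact_iUnion _ fun n => (s n).2⟩ := by
        apply hS.2
        rintro _ ⟨n, rfl⟩
        exact subset_iUnion (fun n => ((s n).1 : Set L)) n
      exact this
    obtain ⟨t, ht⟩ := hK.elim_finite_subcover (fun n => ((s n).1 : Set L))
      (fun n => (s n).1.isOpen) ((hKO.trans hVS).trans hSU)
    obtain ⟨n, hn⟩ := t.bddAbove
    refine ⟨n, fun Z hZ => ?_⟩
    change W ⊆ _
    refine (hWK.trans ht).trans (iUnion₂_subset fun i hi => ?_)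
    exact hZ i (hn hi)

open TopologicalSpace in
theorem goodBase_comp (L : Type*) [TopologicalSpace L]
    (hL : ∀ (O : Opens L), ∀ x ∈ O, ∃ U ∈ CompOpens L, x ∈ U ∧ U ≤ O) :
    GoodBase L (CompOpens L) (· ≤ ·) where
  bot_mem := isCompact_empty
  sup_mem _ hU _ hV := IsCompact.union hU hV
  base := hL
  cpt _ V h := ⟨V.1, V.2, h, subset_rfl⟩
  cover V _ hx := ⟨V, le_rfl, hx⟩

open TopologicalSpace in
/-- a homeomorphism induces an order isomorphism between invariant classes of opens -/
theorem opens_iso_of_homeo {L M : Type*} [TopologicalSpace L] [TopologicalSpace M] (h : L ≃ₜ M)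
    (Q : Set (Opens L)) (Q' : Set (Opens M))
    (hQ : ∀ O : Opens L, O ∈ Q ↔ h.opensCongr O ∈ Q') : Nonempty (Q ≃o Q') :=
  ⟨{ toEquiv := h.opensCongr.toEquiv.subtypeEquiv hQ
     map_rel_iff' := by
      intro a b
      exact h.opensCongr.le_iff_le (x := a.1) (y := b.1) }⟩

open TopologicalSpace in
theorem sigma_iso_of_homeo {L M : Type*} [TopologicalSpace L] [TopologicalSpace M] (h : L ≃ₜ M) :
    Nonempty (SigmaOpens L ≃o SigmaOpens M) := by
  refine opens_iso_of_homeo h _ _ fun O => ?_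
  change IsSigmaCompact (O : Set L) ↔ IsSigmaCompact (h.symm ⁻¹' (O : Set L))
  rw [← h.image_eq_preimage_symm]
  exact h.isEmbedding.isSigmaCompact_iff

open TopologicalSpace in
theorem comp_iso_of_homeo {L M : Type*} [TopologicalSpace L] [TopologicalSpace M] (h : L ≃ₜ M) :
    Nonempty (CompOpens L ≃o CompOpens M) := by
  refine opens_iso_of_homeo h _ _ fun O => ?_
  change IsCompact (O : Set L) ↔ IsCompact (h.symm ⁻¹' (O : Set L))
  rw [← h.image_eq_preimage_symm]
  exact h.isCompact_image.symm

theorem comap_neBot_of_dense {A B : Type*} [TopologicalSpace B] {f : A → B} (hf : DenseRange f)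
    (p : B) : (comap f (𝓝 p)).NeBot := by
  refine comap_neBot fun t ht => ?_
  obtain ⟨_, hy, a, rfl⟩ := mem_closure_iff_nhds.1 (hf p) t ht
  exact ⟨a, hy⟩

namespace OnePointExt

theorem continuous_tau (T : OnePointExt X) : Continuous T.tau :=
  continuous_stoneCechExtend _

theorem tau_unit (T : OnePointExt X) (x : X) :
    T.tau (stoneCechUnit x) = stoneCechUnit (T.ι x) :=
  stoneCechExtend_stoneCechUnit _ x

theorem ι_ne_pt (T : OnePointExt X) (x : X) : T.ι x ≠ T.pt := by
  have : T.ι x ∈ ({T.pt}ᶜ : Set T.carrier) := T.range_eq ▸ mem_range_self x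
  exact this

theorem cases_pt (T : OnePointExt X) (y : T.carrier) : y = T.pt ∨ ∃ x, T.ι x = y := by
  by_cases h : y = T.pt
  · exact Or.inl h
  · have : y ∈ range T.ι := by rw [T.range_eq]; exact h
    exact Or.inr this

theorem isOpenEmbedding (T : OnePointExt X) : IsOpenEmbedding T.ι :=
  ⟨T.emb, by rw [T.range_eq]; exact isOpen_compl_singleton⟩

theorem tau_surjective (T : OnePointExt X) : Function.Surjective T.tau := by
  have h1 : IsClosed (range T.tau) := (isCompact_range T.continuous_tau).isClosed
  have h2 : DenseRange (T.tau ∘ stoneCechUnit) := by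
    have : T.tau ∘ stoneCechUnit = stoneCechUnit ∘ T.ι := funext T.tau_unit
    rw [this]
    exact denseRange_stoneCechUnit.comp T.dense continuous_stoneCechUnit
  have h3 : Dense (range T.tau) := h2.mono (range_comp_subset_range _ _)
  rw [← range_eq_univ, ← h1.closure_eq, h3.closure_eq]

theorem isClosed_theta (T : OnePointExt X) : IsClosed T.theta :=
  isClosed_singleton.preimage T.continuous_tau

theorem theta_nonempty (T : OnePointExt X) : T.theta.Nonempty :=
  T.tau_surjective _

theorem unit_notMem_theta (T : OnePointExt X) (x : X) : stoneCechUnit x ∉ T.theta := by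
  intro h
  have h1 : T.tau (stoneCechUnit x) = stoneCechUnit T.pt := h
  rw [tau_unit] at h1
  exact T.ι_ne_pt x (isEmbedding_stoneCechUnit.injective h1)

/-- Points of `βX` mapped into `X` are in `X`. -/
theorem tau_eq_unit [T35Space X] (T : OnePointExt X) {p : StoneCech X} {x : X}
    (h : T.tau p = stoneCechUnit (T.ι x)) : p = stoneCechUnit x := by
  have hne : (comap stoneCechUnit (𝓝 p)).NeBot := comap_neBot_of_dense denseRange_stoneCechUnit p
  have h1 : Tendsto (stoneCechUnit : X → StoneCech X) (comap stoneCechUnit (𝓝 p)) (𝓝 p) :=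
    tendsto_comap
  have h2 := (T.continuous_tau.tendsto p).comp h1
  rw [h] at h2
  have h3 : Tendsto (fun y => stoneCechUnit (T.ι y)) (comap stoneCechUnit (𝓝 p))
      (𝓝 (stoneCechUnit (T.ι x))) := h2.congr fun y => T.tau_unit y
  have h4 : Tendsto (fun y : X => y) (comap stoneCechUnit (𝓝 p)) (𝓝 x) :=
    ((isEmbedding_stoneCechUnit.comp T.emb).tendsto_nhds_iff).2 h3
  exact tendsto_nhds_unique h1 ((continuous_stoneCechUnit.tendsto x).comp h4)

/-- Θ computed through any compactification. -/
theorem theta_eq (T : OnePointExt X) {Z : Type*} [TopologicalSpace Z] [T2Space Z] [CompactSpace Z]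
    (e : T.carrier → Z) (he : IsEmbedding e) (F : StoneCech X → Z) (hF : Continuous F)
    (hFe : ∀ x, F (stoneCechUnit x) = e (T.ι x)) : T.theta = F ⁻¹' {e T.pt} := by
  have hcomp : stoneCechExtend he.continuous ∘ T.tau = F := by
    apply (denseRange_stoneCechUnit (α := X)).equalizer
      ((continuous_stoneCechExtend _).comp T.continuous_tau) hF
    funext x
    simp only [Function.comp, tau_unit, stoneCechExtend_stoneCechUnit, hFe]
  ext p
  constructor
  · intro hp
    have hp : T.tau p = stoneCechUnit T.pt := hp
    change F p = e T.pt
    rw [← hcomp]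
    simp only [Function.comp, hp, stoneCechExtend_stoneCechUnit]
  · intro hp
    have hp : F p = e T.pt := hp
    have hne : (comap stoneCechUnit (𝓝 p)).NeBot :=
      comap_neBot_of_dense denseRange_stoneCechUnit p
    have h1 : Tendsto (stoneCechUnit : X → StoneCech X) (comap stoneCechUnit (𝓝 p)) (𝓝 p) :=
      tendsto_comap
    have h2 := (hF.tendsto p).comp h1
    rw [hp] at h2
    have h3 : Tendsto (fun x => e (T.ι x)) (comap stoneCechUnit (𝓝 p)) (𝓝 (e T.pt)) :=
      h2.congr fun y => hFe y
    have h4 : Tendsto T.ι (comap stoneCechUnit (𝓝 p)) (𝓝 T.pt) := he.tendsto_nhds_iff.2 h3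
    have h5 := (continuous_stoneCechUnit.tendsto T.pt).comp h4
    have h6 : Tendsto (fun x => stoneCechUnit (T.ι x)) (comap stoneCechUnit (𝓝 p)) (𝓝 (T.tau p)) :=
      ((T.continuous_tau.tendsto p).comp h1).congr fun y => T.tau_unit y
    exact tendsto_nhds_unique h6 h5

theorem map_pt (T1 T2 : OnePointExt X) (f : T2.carrier → T1.carrier) (hf : Continuous f)
    (hfx : ∀ x, f (T2.ι x) = T1.ι x) : f T2.pt = T1.pt := by
  rcases T1.cases_pt (f T2.pt) with h | ⟨x, hx⟩
  · exact h
  · exfalso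
    have hne : (comap T2.ι (𝓝 T2.pt)).NeBot := comap_neBot_of_dense T2.dense _
    have h1 : Tendsto T2.ι (comap T2.ι (𝓝 T2.pt)) (𝓝 T2.pt) := tendsto_comap
    have h2 := (hf.tendsto T2.pt).comp h1
    rw [← hx] at h2
    have h3 : Tendsto (fun y => T1.ι y) (comap T2.ι (𝓝 T2.pt)) (𝓝 (T1.ι x)) := h2.congr hfx
    have h4 : Tendsto (fun y : X => y) (comap T2.ι (𝓝 T2.pt)) (𝓝 x) := T1.emb.tendsto_nhds_iff.2 h3
    have h5 : Tendsto T2.ι (comap T2.ι (𝓝 T2.pt)) (𝓝 (T2.ι x)) :=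
      (T2.emb.continuous.tendsto x).comp h4
    exact T2.ι_ne_pt x (tendsto_nhds_unique h5 h1)

/-- `b` a nbhd of the added point: the points outside stay away from Θ. -/
theorem le_iff (T1 T2 : OnePointExt X) : T1.le T2 ↔ T2.theta ⊆ T1.theta := by
  constructor
  · rintro ⟨f, hf, hfx⟩ p hp
    have hp : T2.tau p = stoneCechUnit T2.pt := hp
    let g : StoneCech T2.carrier → StoneCech T1.carrier :=
      stoneCechExtend (continuous_stoneCechUnit.comp hf)
    have hcomp : g ∘ T2.tau = T1.tau := by
      apply (denseRange_stoneCechUnit (α := X)).equalizer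
        ((continuous_stoneCechExtend _).comp T2.continuous_tau) T1.continuous_tau
      funext x
      simp only [Function.comp, tau_unit, stoneCechExtend_stoneCechUnit, hfx]
    change T1.tau p = stoneCechUnit T1.pt
    rw [← hcomp]
    simp only [Function.comp, hp, g, stoneCechExtend_stoneCechUnit, map_pt T1 T2 f hf hfx]
  · intro h
    classical
    let f : T2.carrier → T1.carrier := fun y =>
      if hy : ∃ x, T2.ι x = y then T1.ι hy.choose else T1.pt
    have hfx : ∀ x, f (T2.ι x) = T1.ι x := by
      intro x
      have hy : ∃ x', T2.ι x' = T2.ι x := ⟨x, rfl⟩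
      simp only [f, dif_pos hy]
      congr 1
      exact T2.emb.injective hy.choose_spec
    have hfpt : f T2.pt = T1.pt := by
      simp only [f]
      rw [dif_neg]
      rintro ⟨x, hx⟩
      exact T2.ι_ne_pt x hx
    refine ⟨f, continuous_iff_continuousAt.2 fun y => ?_, hfx⟩
    rcases T2.cases_pt y with rfl | ⟨x, rfl⟩
    · rw [ContinuousAt, hfpt]
      rw [isEmbedding_stoneCechUnit.tendsto_nhds_iff (f := f)]
      rw [tendsto_nhds]
      intro W hW hptW
      let N : Set (StoneCech T2.carrier) := (T2.tau '' (T1.tau ⁻¹' W)ᶜ)ᶜ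
      have hN : IsOpen N := by
        refine IsClosed.isOpen_compl (self := ?_)
        exact ((hW.preimage T1.continuous_tau).isClosed_compl.isCompact.image
          T2.continuous_tau).isClosed
      have hptN : stoneCechUnit T2.pt ∈ N := by
        rintro ⟨q, hq, hqp⟩
        have h1 : q ∈ T1.theta := h hqp
        have h2 : T1.tau q = stoneCechUnit T1.pt := h1
        exact hq (by rw [mem_preimage, h2]; exact hptW)
      filter_upwards [(hN.preimage continuous_stoneCechUnit).mem_nhds hptN] with y hy
      rcases T2.cases_pt y with rfl | ⟨x, rfl⟩
      · change stoneCechUnit (f T2.pt) ∈ W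
        rw [hfpt]; exact hptW
      · change stoneCechUnit (f (T2.ι x)) ∈ W
        rw [hfx]
        by_contra hc
        exact hy ⟨stoneCechUnit x, by rwa [mem_compl_iff, mem_preimage, tau_unit], T2.tau_unit x⟩
    · rw [T2.isOpenEmbedding.continuousAt_iff.symm]
      have : f ∘ T2.ι = T1.ι := funext hfx
      rw [this]
      exact T1.emb.continuous.continuousAt

theorem equiv_iff (T1 T2 : OnePointExt X) : T1.equiv T2 ↔ T1.le T2 ∧ T2.le T1 := by
  constructor
  · rintro ⟨h, hh⟩
    exact ⟨⟨h.symm, h.symm.continuous, fun x => by rw [← hh, h.symm_apply_apply]⟩,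
      ⟨h, h.continuous, hh⟩⟩
  · rintro ⟨⟨f, hf, hfx⟩, ⟨g, hg, hgx⟩⟩
    refine ⟨⟨⟨g, f, ?_, ?_⟩, hg, hf⟩, hgx⟩
    · intro y
      exact congrFun (T1.dense.equalizer (hf.comp hg) continuous_id
        (funext fun x => by simp [hfx, hgx])) y
    · intro y
      exact congrFun (T2.dense.equalizer (hg.comp hf) continuous_id
        (funext fun x => by simp [hfx, hgx])) y

theorem tau_preimage_range [T35Space X] (T : OnePointExt X) :
    T.tau ⁻¹' (range stoneCechUnit)ᶜ = (range (stoneCechUnit : X → StoneCech X))ᶜ \ T.theta := by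
  ext p
  constructor
  · intro hp
    refine ⟨?_, fun h => hp ⟨T.pt, h.symm⟩⟩
    rintro ⟨x, rfl⟩
    exact hp ⟨T.ι x, (T.tau_unit x).symm⟩
  · rintro ⟨hp, hp2⟩ ⟨y, hy⟩
    rcases T.cases_pt y with rfl | ⟨x, rfl⟩
    · exact hp2 hy.symm
    · exact hp ⟨x, (T.tau_eq_unit hy.symm).symm⟩

theorem tau_image_compl [T35Space X] (T : OnePointExt X) :
    T.tau '' ((range (stoneCechUnit : X → StoneCech X))ᶜ \ T.theta) = (range stoneCechUnit)ᶜ := by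
  rw [← tau_preimage_range, image_preimage_eq _ T.tau_surjective]

theorem cech_iff [T35Space X] (T : OnePointExt X) : CechComplete T.carrier ↔
    IsSigmaCompact ((range (stoneCechUnit : X → StoneCech X))ᶜ \ T.theta) := by
  constructor
  · intro h
    obtain ⟨V, hV, hVe⟩ := isGδ_iff_eq_iInter_nat.1 h
    rw [← tau_preimage_range, hVe, compl_iInter, preimage_iUnion]
    exact isSigmaCompact_iUnion _ fun n =>
      ((hV n).isClosed_compl.preimage T.continuous_tau).isCompact.isSigmaCompact
  · rintro ⟨K, hK, hKe⟩
    have h1 := T.tau_image_compl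
    rw [← hKe, image_iUnion] at h1
    refine isGδ_iff_eq_iInter_nat.2 ⟨fun n => (T.tau '' K n)ᶜ, fun n =>
      ((hK n).image T.continuous_tau).isClosed.isOpen_compl, ?_⟩
    rw [← compl_iUnion, h1, compl_compl]

end OnePointExt

theorem isOpen_range_unit (Z : Type*) [TopologicalSpace Z] [T35Space Z] [LocallyCompactSpace Z] :
    IsOpen (range (stoneCechUnit : Z → StoneCech Z)) := by
  rw [isOpen_iff_mem_nhds]
  rintro _ ⟨x, rfl⟩
  obtain ⟨K, hK, hxK⟩ := exists_compact_mem_nhds x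
  rw [(isInducing_stoneCechUnit (X := Z)).nhds_eq_comap] at hxK
  obtain ⟨W', hW', hWK⟩ := hxK
  obtain ⟨W, hWW', hW, hxW⟩ := mem_nhds_iff.1 hW'
  filter_upwards [hW.mem_nhds hxW] with p hp
  have h1 : p ∈ closure (W ∩ range (stoneCechUnit : Z → StoneCech Z)) :=
    denseRange_stoneCechUnit.open_subset_closure_inter hW hp
  have h2 : closure (W ∩ range (stoneCechUnit : Z → StoneCech Z)) ⊆ stoneCechUnit '' K := by
    apply closure_minimal _ (hK.image continuous_stoneCechUnit).isClosed
    rintro _ ⟨hq, y, rfl⟩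
    exact ⟨y, hWK (hWW' hq), rfl⟩
  exact image_subset_range _ _ (h2 h1)

theorem OnePointExt.lc_iff [T35Space X] (T : OnePointExt X) : LocallyCompactSpace T.carrier ↔
    IsCompact ((range (stoneCechUnit : X → StoneCech X))ᶜ \ T.theta) := by
  constructor
  · intro h
    rw [← tau_preimage_range]
    exact ((isOpen_range_unit T.carrier).isClosed_compl.preimage T.continuous_tau).isCompact
  · intro h
    have h1 : IsClosed ((range (stoneCechUnit : T.carrier → _))ᶜ) := by
      rw [← T.tau_image_compl]
      exact (h.image T.continuous_tau).isClosed
    have h2 : IsOpenEmbedding (stoneCechUnit : T.carrier → StoneCech T.carrier) :=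
      ⟨isEmbedding_stoneCechUnit, by simpa using h1.isOpen_compl⟩
    exact h2.locallyCompactSpace

/-- Every nonempty closed subset of `βX \ X` is Θ of some extension. -/
theorem exists_ext [T35Space X] (C : Set (StoneCech X)) (hC : IsClosed C) (hne : C.Nonempty)
    (hCX : ∀ x : X, stoneCechUnit x ∉ C) : ∃ T : OnePointExt X, T.theta = C := by
  let J := {g : C(StoneCech X, ℝ) // (∀ p ∈ C, g p = 0) ∧ ∀ p, g p ∈ Icc (0:ℝ) 1}
  let Ψ : StoneCech X → (J → Icc (0:ℝ) 1) := fun p g => ⟨g.1 p, g.2.2 p⟩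
  have hΨ : Continuous Ψ := continuous_pi fun g => g.1.continuous.subtype_mk _
  let z : J → Icc (0:ℝ) 1 := fun g => ⟨0, by simp⟩
  have sep : ∀ (p : StoneCech X) (D : Set (StoneCech X)), IsClosed D → p ∉ D → p ∉ C →
      ∃ g : J, g.1 p = 1 ∧ ∀ q ∈ D, g.1 q = 0 := by
    intro p D hD hpD hpC
    obtain ⟨f, hf0, hf1, hf⟩ := exists_continuous_zero_one_of_isClosed (hC.union hD)
      (isClosed_singleton (x := p)) (by simp [hpC, hpD])
    exact ⟨⟨f, fun q hq => hf0 (Or.inl hq), hf⟩, hf1 rfl, fun q hq => hf0 (Or.inr hq)⟩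
  have hΨC : ∀ p, Ψ p = z ↔ p ∈ C := by
    intro p
    constructor
    · intro h
      by_contra hp
      obtain ⟨g, hg, -⟩ := sep p ∅ isClosed_empty (by simp) hp
      have := congrArg Subtype.val (congrFun h g)
      simp only [Ψ, z, hg] at this
      exact one_ne_zero this
    · intro hp
      funext g
      exact Subtype.ext (g.2.1 p hp)
  let Φ : Option X → (J → Icc (0:ℝ) 1) := fun o => o.elim z fun x => Ψ (stoneCechUnit x)
  have hΦ : Function.Injective Φ := by
    rintro (_ | x) (_ | y) h
    · rfl
    · exact absurd ((hΨC _).1 h.symm) (hCX y)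
    · exact absurd ((hΨC _).1 h) (hCX x)
    · by_contra hxy
      have hxy' : (stoneCechUnit x : StoneCech X) ≠ stoneCechUnit y := fun h' =>
        hxy (congrArg some (isEmbedding_stoneCechUnit.injective h'))
      obtain ⟨g, hg, hg2⟩ := sep (stoneCechUnit x) {stoneCechUnit y} isClosed_singleton hxy' (hCX x)
      have := congrArg Subtype.val (congrFun h g)
      simp only [Φ, Ψ, Option.elim, hg, hg2 _ rfl] at this
      exact one_ne_zero this
  let top : TopologicalSpace (Option X) := TopologicalSpace.induced Φ inferInstance
  have hemb : IsEmbedding Φ := ⟨⟨rfl⟩, hΦ⟩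
  have hsome : IsEmbedding (some : X → Option X) := by
    refine ⟨?_, Option.some_injective X⟩
    have h1 : IsInducing (Φ ∘ (some : X → Option X)) := by
      have hc : Continuous (Φ ∘ (some : X → Option X)) := hΨ.comp continuous_stoneCechUnit
      rw [isInducing_iff_nhds]
      intro x
      apply le_antisymm
      · exact map_le_iff_le_comap.1 (hc.tendsto x)
      · intro U hU
        rw [(isInducing_stoneCechUnit (X := X)).nhds_eq_comap] at hU
        obtain ⟨W', hW', hWU⟩ := hU
        obtain ⟨W, hWW', hW, hxW⟩ := mem_nhds_iff.1 hW'
        obtain ⟨g, hg, hg2⟩ := sep (stoneCechUnit x) Wᶜ hW.isClosed_compl (by simpa using hxW)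
          (hCX x)
        refine ⟨{w | (0:ℝ) < (w g).1}, ?_, ?_⟩
        · apply IsOpen.mem_nhds
          · exact isOpen_lt continuous_const (continuous_subtype_val.comp (continuous_apply g))
          · change (0:ℝ) < g.1 (stoneCechUnit x)
            rw [hg]; exact one_pos
        · intro y hy
          have hy : (0:ℝ) < g.1 (stoneCechUnit y) := hy
          apply hWU
          apply hWW'
          by_contra hc
          rw [hg2 _ hc] at hy
          exact lt_irrefl _ hy
    exact hemb.isInducing.of_comp_iff.1 h1
  have hdense : DenseRange (some : X → Option X) := by
    intro o
    rcases o with _ | x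
    · obtain ⟨c, hc⟩ := hne
      rw [hemb.isInducing.closure_eq_preimage_closure_image, mem_preimage, ← range_comp]
      change z ∈ closure (range (Ψ ∘ stoneCechUnit))
      rw [← (hΨC c).2 hc, range_comp]
      exact image_closure_subset_closure_image hΨ ⟨c, denseRange_stoneCechUnit c, rfl⟩
    · exact subset_closure ⟨x, rfl⟩
  let T : OnePointExt X :=
    { carrier := Option X
      top := top
      t35 := hemb.t35Space
      ι := some
      emb := hsome
      pt := none
      range_eq := by ext o; cases o <;> simp
      dense := hdense }
  refine ⟨T, ?_⟩
  rw [T.theta_eq Φ hemb Ψ hΨ fun x => rfl]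
  ext p
  exact hΨC p

theorem transferP {P : (Z : Type u) → [TopologicalSpace Z] → Prop} (hProp : TopProperty P)
    {A B T : Type u} [TopologicalSpace A] [TopologicalSpace B] [TopologicalSpace T]
    {f : A → T} {g : B → T} (hf : IsEmbedding f) (hg : IsEmbedding g) (h : range f = range g)
    (hA : P A) : P B :=
  hProp A B ((hf.toHomeomorph.trans (Homeomorph.setCongr h)).trans hg.toHomeomorph.symm) hA

theorem pseudocompact_closure {W : Type u} [TopologicalSpace W] [T35Space W]
    (hW : Pseudocompact W) (O : Set W) (hO : IsOpen O) : Pseudocompact (closure O) := by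
  intro g hg
  by_contra! hub
  have hopen : ∀ n : ℕ, ∃ N : Set W, IsOpen N ∧
      (Subtype.val ⁻¹' N : Set (closure O)) = {z | (n : ℝ) < |g z|} := fun n =>
    isOpen_induced_iff.1 (isOpen_lt continuous_const hg.abs)
  choose N hN hNe using hopen
  have hx : ∀ n, ∃ x, x ∈ N n ∩ O := by
    intro n
    obtain ⟨z, hz⟩ := hub n
    have : z ∈ (Subtype.val ⁻¹' N n : Set (closure O)) := by rw [hNe]; exact hz
    exact mem_closure_iff.1 z.2 (N n) (hN n) this
  choose x hx using hx
  choose f hf hfx hf1 using fun n => CompletelyRegularSpace.completely_regular_isOpen (x n) (N n ∩ O)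
    ((hN n).inter hO) (hx n)
  let φ : ℕ → W → ℝ := fun n w => n * (1 - (f n w : ℝ))
  have hφ0 : ∀ n w, 0 ≤ φ n w := fun n w =>
    mul_nonneg (Nat.cast_nonneg n) (sub_nonneg.2 (f n w).2.2)
  have hsupp : ∀ n, Function.support (φ n) ⊆ N n ∩ O := by
    intro n w hw
    by_contra hc
    have : f n w = 1 := hf1 n hc
    exact hw (by simp [φ, this])
  have hlf : LocallyFinite fun n => Function.support (φ n) := by
    refine LocallyFinite.subset (g := fun n => Function.support (φ n)) (f := fun n => N n ∩ O) ?_ hsupp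
    intro w
    by_cases hw : w ∈ closure O
    · obtain ⟨V, hV, hVe⟩ := isOpen_induced_iff.1
        (isOpen_lt hg.abs (continuous_const (y := |g ⟨w, hw⟩| + 1)))
      have hwV : (⟨w, hw⟩ : closure O) ∈ (Subtype.val ⁻¹' V : Set (closure O)) := by
        rw [hVe]; exact lt_add_one |g ⟨w, hw⟩|
      refine ⟨V, hV.mem_nhds hwV, ?_⟩
      obtain ⟨m, hm⟩ := exists_nat_gt (|g ⟨w, hw⟩| + 1)
      refine (finite_lt_nat m).subset ?_
      rintro n ⟨y, ⟨hyN, hyO⟩, hyV⟩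
      have h1 : (⟨y, subset_closure hyO⟩ : closure O) ∈ (Subtype.val ⁻¹' V : Set (closure O)) := hyV
      have h2 : (⟨y, subset_closure hyO⟩ : closure O) ∈ (Subtype.val ⁻¹' N n : Set (closure O)) :=
        hyN
      rw [hVe] at h1
      rw [hNe] at h2
      have h3 : (n : ℝ) < m := lt_trans (lt_trans h2 h1) hm
      exact_mod_cast h3
    · refine ⟨(closure O)ᶜ, isClosed_closure.isOpen_compl.mem_nhds hw, ?_⟩
      convert finite_empty
      ext n
      simp only [mem_empty_iff_false, iff_false]
      rintro ⟨y, ⟨-, hyO⟩, hy⟩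
      exact hy (subset_closure hyO)
  obtain ⟨M, hM⟩ := hW (fun w => ∑ᶠ n, φ n w) (continuous_finsum (fun n => by
    have := hf n
    fun_prop) hlf)
  obtain ⟨n, hn⟩ := exists_nat_gt M
  have h1 : φ n (x n) ≤ ∑ᶠ k, φ k (x n) :=
    single_le_finsum (f := fun k => φ k (x n)) n (hlf.point_finite (x n)) fun k => hφ0 k _
  have h2 : φ n (x n) = n := by simp [φ, hfx]
  have h3 := (le_abs_self _).trans (hM (x n))
  linarith

/-- What is needed from the property. -/
structure GoodP (P : (Z : Type u) → [TopologicalSpace Z] → Prop) : Prop where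
  h1 : ∀ (Z : Type u) [TopologicalSpace Z] [T35Space Z], P Z → ∀ O : Set Z, IsOpen O → P (closure O)
  h2 : ∀ (T : Type u) [TopologicalSpace T] [T35Space T] (p : T),
    (∀ b : Set T, IsOpen b → p ∈ b → ∃ (n : ℕ) (F : Fin n → Set T),
      (∀ i, P (F i) ∧ IsClosed (F i ∩ bᶜ)) ∧ bᶜ ⊆ ⋃ i, F i) → P T
  h3 : ∀ (Z : Type u) [TopologicalSpace Z] [T35Space Z] (n : ℕ) (F : Fin n → Set Z),
    (∀ i, IsClosed (F i)) → (∀ i, P (F i)) → (⋃ i, F i) = univ → P Z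

theorem bdd_on_pieces {T : Type u} [TopologicalSpace T] {n : ℕ} (F : Fin n → Set T)
    (hF : ∀ i, Pseudocompact (F i)) (g : T → ℝ) (hg : Continuous g) :
    ∃ M, ∀ i, ∀ t ∈ F i, |g t| ≤ M := by
  choose M hM using fun i => hF i (fun t => g t.1) (hg.comp continuous_subtype_val)
  obtain ⟨B, hB⟩ := (finite_range M).bddAbove
  exact ⟨B, fun i t ht => (hM i ⟨t, ht⟩).trans (hB ⟨i, rfl⟩)⟩

theorem goodP {P : (Z : Type u) → [TopologicalSpace Z] → Prop} (hProp : TopProperty P)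
    (hP : IsPseudocompactness P ∨ (ClosedHereditary P ∧ MrowkaW P ∧ FiniteClosedSums P)) :
    GoodP P := by
  rcases hP with hP | ⟨hCH, hM, hFS⟩
  · refine ⟨fun Z _ _ hZ O hO => ?_, fun T _ _ p h => ?_, fun Z _ _ n F hF hFP hU => ?_⟩
    · rw [hP] at hZ ⊢
      exact pseudocompact_closure hZ O hO
    · rw [hP]
      intro g hg
      obtain ⟨n, F, hF, hcov⟩ := h {t | |g t| < |g p| + 1} (isOpen_lt hg.abs continuous_const)
        (lt_add_one |g p|)
      obtain ⟨M, hM⟩ := bdd_on_pieces F (fun i => (hP _).1 (hF i).1) g hg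
      refine ⟨max M (|g p| + 1), fun t => ?_⟩
      by_cases ht : |g t| < |g p| + 1
      · exact ht.le.trans (le_max_right _ _)
      · obtain ⟨i, hi⟩ := mem_iUnion.1 (hcov ht)
        exact (hM i t hi).trans (le_max_left _ _)
    · rw [hP]
      intro g hg
      obtain ⟨M, hM⟩ := bdd_on_pieces F (fun i => (hP _).1 (hFP i)) g hg
      refine ⟨M, fun t => ?_⟩
      obtain ⟨i, hi⟩ := mem_iUnion.1 (hU ▸ mem_univ t)
      exact hM i t hi
  · refine ⟨fun Z _ _ hZ O hO => hCH Z hZ _ isClosed_closure, fun T _ _ p h => ?_,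
      fun Z _ _ n F hF hFP hU => hFS Z n F hF hFP hU⟩
    refine hM T p {b | IsOpen b ∧ p ∈ b} (fun b hb => hb) (fun V hV hp => ⟨V, ⟨hV, hp⟩, subset_rfl⟩) ?_
    rintro b ⟨hb, hpb⟩
    obtain ⟨n, F, hF, hcov⟩ := h b hb hpb
    refine hFS _ n (fun i => Subtype.val ⁻¹' F i) (fun i => ?_) (fun i => ?_) ?_
    · have h1 := (hF i).2.preimage (continuous_subtype_val (p := fun t => t ∈ bᶜ))
      convert h1 using 1
      ext t
      exact ⟨fun h => ⟨h, t.2⟩, fun h => h.1⟩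
    · have h1 : P (Subtype.val ⁻¹' bᶜ : Set (F i)) :=
        hCH _ (hF i).1 _ (hb.isClosed_compl.preimage continuous_subtype_val)
      refine transferP hProp (IsEmbedding.subtypeVal.comp IsEmbedding.subtypeVal)
        (IsEmbedding.subtypeVal.comp IsEmbedding.subtypeVal) ?_ h1
      rw [range_comp, range_comp, Subtype.range_val, Subtype.range_val,
        Subtype.image_preimage_coe, Subtype.image_preimage_coe, inter_comm]
    · rw [eq_univ_iff_forall]
      intro t
      obtain ⟨i, hi⟩ := mem_iUnion.1 (hcov t.2)
      exact mem_iUnion.2 ⟨i, hi⟩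

theorem isOpen_lambdaP (P : (Z : Type u) → [TopologicalSpace Z] → Prop) :
    IsOpen (lambdaP P X) :=
  isOpen_biUnion fun _ _ => isOpen_interior

/-- A compact subset of `λ_P X` is covered by finitely many pieces with `P`. -/
theorem lambda_compact [T35Space X] {P : (Z : Type u) → [TopologicalSpace Z] → Prop}
    (K : Set (StoneCech X)) (hK : IsCompact K) (hKl : K ⊆ lambdaP P X) :
    ∃ (n : ℕ) (C : Fin n → Set X), (∀ i, P (closure (C i))) ∧
      stoneCechUnit ⁻¹' K ⊆ ⋃ i, closure (C i) := by
  let J := {C : Set X // IsCozeroSet C ∧ P (closure C)}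
  obtain ⟨t, ht⟩ := hK.elim_finite_subcover
    (fun C : J => interior (closure (stoneCechUnit '' C.1))) (fun _ => isOpen_interior) (by
      intro p hp
      obtain ⟨C, hC, hpC⟩ := mem_iUnion₂.1 (hKl hp)
      exact mem_iUnion.2 ⟨⟨C, hC⟩, hpC⟩)
  refine ⟨t.card, fun i => (t.equivFin.symm i).1.1, fun i => (t.equivFin.symm i).1.2.2, ?_⟩
  intro x hx
  obtain ⟨C, hCt, hxC⟩ := mem_iUnion₂.1 (ht hx)
  refine mem_iUnion.2 ⟨t.equivFin ⟨C, hCt⟩, ?_⟩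
  beta_reduce
  rw [Equiv.symm_apply_apply, (isInducing_stoneCechUnit (X := X)).closure_eq_preimage_closure_image]
  have h := interior_subset hxC
  exact h

/-- Criterion for membership in `λ_P X`. -/
theorem mem_lambda [T35Space X] {P : (Z : Type u) → [TopologicalSpace Z] → Prop}
    (p : StoneCech X) (D : Set (StoneCech X)) (hD : IsClosed D) (hpD : p ∉ D)
    (h : ∀ C : Set X, IsOpen C → Disjoint (closure (stoneCechUnit '' C)) D → P (closure C)) :
    p ∈ lambdaP P X := by
  obtain ⟨f, hf0, hf1, hf⟩ := exists_continuous_zero_one_of_isClosed hD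
      (isClosed_singleton (x := p)) (by simpa using hpD)
  let W : Set (StoneCech X) := {q | 1 / 2 < f q}
  have hW : IsOpen W := isOpen_lt continuous_const f.continuous
  have hcl : closure ((stoneCechUnit : X → StoneCech X) '' (stoneCechUnit ⁻¹' W)) ⊆ {q | 1 / 2 ≤ f q} := by
    apply closure_minimal _ (isClosed_le continuous_const f.continuous)
    rintro _ ⟨x, hx, rfl⟩
    exact le_of_lt (show 1 / 2 < f (stoneCechUnit x) from hx)
  refine mem_iUnion₂.2 ⟨stoneCechUnit ⁻¹' W, ⟨?_, ?_⟩, ?_⟩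
  · refine ⟨fun x => projIcc 0 1 zero_le_one (f (stoneCechUnit x) - 1 / 2), ?_, ?_⟩
    · exact continuous_projIcc.comp
        ((f.continuous.comp continuous_stoneCechUnit).sub continuous_const)
    · ext x
      simp only [mem_preimage, mem_compl_iff, mem_singleton_iff]
      rw [show (0 : unitInterval) = ⟨0, left_mem_Icc.2 zero_le_one⟩ from rfl, projIcc_eq_left one_pos]
      simp [W]
  · apply h _ (hW.preimage continuous_stoneCechUnit)
    rw [disjoint_left]
    intro q hq hqD
    have h1 : 1 / 2 ≤ f q := hcl hq
    have h2 : f q = 0 := hf0 hqD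
    linarith
  · refine mem_interior.2 ⟨W, ?_, hW, ?_⟩
    · have := denseRange_stoneCechUnit (α := X) |>.open_subset_closure_inter hW
      rwa [image_preimage_eq_inter_range]
    · have : f p = 1 := hf1 rfl
      change 1 / 2 < f p
      rw [this]; norm_num

section
variable [T35Space X] {P : (Z : Type u) → [TopologicalSpace Z] → Prop}

theorem unit_mem_lambda (hProp : TopProperty P) (hG : GoodP P) (hloc : LocallyP P X) (x : X) :
    stoneCechUnit x ∈ lambdaP P X := by
  obtain ⟨U, hU, hxU, hPU⟩ := hloc x
  obtain ⟨W, hW, hWU⟩ := (isInducing_stoneCechUnit (X := X)).isOpen_iff.1 hU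
  refine mem_lambda _ Wᶜ hW.isClosed_compl (by
    have : x ∈ stoneCechUnit ⁻¹' W := hWU ▸ hxU
    simpa using this) fun C hC hdis => ?_
  have hCU : C ⊆ U := by
    intro y hy
    rw [← hWU]
    by_contra hc
    exact disjoint_left.1 hdis (subset_closure ⟨y, hy, rfl⟩) hc
  have h1 : P (closure (Subtype.val ⁻¹' C : Set (closure U))) :=
    hG.h1 _ hPU _ (hC.preimage continuous_subtype_val)
  refine transferP hProp (IsEmbedding.subtypeVal.comp IsEmbedding.subtypeVal)
        IsEmbedding.subtypeVal ?_ h1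
  rw [range_comp, Subtype.range_val, Subtype.range_val,
    ← (isClosed_closure (s := U)).isClosedEmbedding_subtypeVal.closure_image_eq,
    image_preimage_eq_inter_range, Subtype.range_val,
    inter_eq_left.2 (hCU.trans subset_closure)]

theorem lambda_ne_univ (hG : GoodP P) (hn : ¬ P X) : ∃ p, p ∉ lambdaP P X := by
  by_contra! h
  obtain ⟨n, C, hC, hcov⟩ := lambda_compact (P := P) (univ : Set (StoneCech X)) isCompact_univ
    fun p _ => h p
  exact hn (hG.h3 X n _ (fun i => isClosed_closure) hC (univ_subset_iff.1 hcov))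

theorem P_iff (hProp : TopProperty P) (hG : GoodP P) (T : OnePointExt X) :
    P T.carrier ↔ (lambdaP P X)ᶜ ⊆ T.theta := by
  constructor
  · intro hT p hp
    by_contra hpT
    refine hp (mem_lambda p T.theta T.isClosed_theta hpT fun C hC hdis => ?_)
    have h1 : P (closure (T.ι '' C)) := hG.h1 _ hT _ (T.isOpenEmbedding.isOpenMap _ hC)
    refine transferP hProp IsEmbedding.subtypeVal (T.emb.comp IsEmbedding.subtypeVal) ?_ h1
    rw [range_comp, Subtype.range_val, Subtype.range_val]
    apply Subset.antisymm
    · intro y hy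
      rcases T.cases_pt y with rfl | ⟨x, rfl⟩
      · exfalso
        have h2 : stoneCechUnit T.pt ∈ T.tau '' closure (stoneCechUnit '' C) := by
          have h3 : closure (stoneCechUnit '' (T.ι '' C)) ⊆
              T.tau '' closure (stoneCechUnit '' C) := by
            apply closure_minimal _ (isClosed_closure.isCompact.image T.continuous_tau).isClosed
            rintro _ ⟨_, ⟨x, hx, rfl⟩, rfl⟩
            exact ⟨_, subset_closure ⟨x, hx, rfl⟩, T.tau_unit x⟩
          exact h3 (image_closure_subset_closure_image continuous_stoneCechUnit ⟨_, hy, rfl⟩)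
        obtain ⟨q, hq, hqp⟩ := h2
        exact disjoint_left.1 hdis hq hqp
      · refine ⟨x, ?_, rfl⟩
        rw [T.emb.isInducing.closure_eq_preimage_closure_image]
        exact hy
    · exact image_closure_subset_closure_image T.emb.continuous
  · intro h
    refine hG.h2 _ T.pt fun b hb hptb => ?_
    let K : Set (StoneCech X) := T.tau ⁻¹' closure (stoneCechUnit '' bᶜ)
    have hK : IsClosed K := isClosed_closure.preimage T.continuous_tau
    have hKl : K ⊆ lambdaP P X := by
      intro p hp
      by_contra hc
      have h1 : T.tau p = stoneCechUnit T.pt := h hc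
      have h2 : T.tau p ∈ closure (stoneCechUnit '' bᶜ) := hp
      rw [h1, ← mem_preimage,
        ← (isInducing_stoneCechUnit (X := T.carrier)).closure_eq_preimage_closure_image,
        hb.isClosed_compl.closure_eq] at h2
      exact h2 hptb
    obtain ⟨n, C, hC, hcov⟩ := lambda_compact K hK.isCompact hKl
    refine ⟨n, fun i => T.ι '' closure (C i), fun i => ⟨?_, ?_⟩, ?_⟩
    · exact hProp _ _ (T.emb.homeomorphImage _) (hC i)
    · have : T.ι '' closure (C i) ∩ bᶜ = closure (T.ι '' C i) ∩ bᶜ := by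
        ext y
        constructor
        · exact fun hy => ⟨image_closure_subset_closure_image T.emb.continuous hy.1, hy.2⟩
        · rintro ⟨hy, hyb⟩
          rcases T.cases_pt y with rfl | ⟨x, rfl⟩
          · exact absurd hptb hyb
          · refine ⟨⟨x, ?_, rfl⟩, hyb⟩
            rw [T.emb.isInducing.closure_eq_preimage_closure_image]
            exact hy
      rw [this]
      exact isClosed_closure.inter hb.isClosed_compl
    · intro y hy
      rcases T.cases_pt y with rfl | ⟨x, rfl⟩
      · exact absurd hptb hy
      · have hx : x ∈ stoneCechUnit ⁻¹' K := by
          change T.tau (stoneCechUnit x) ∈ closure (stoneCechUnit '' bᶜ)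
          rw [T.tau_unit]
          exact subset_closure ⟨_, hy, rfl⟩
        obtain ⟨i, hi⟩ := mem_iUnion.1 (hcov hx)
        exact mem_iUnion.2 ⟨i, x, hi, rfl⟩

end

/-- The space `λ_P X \ X`. -/
abbrev Lsp (P : (Z : Type u) → [TopologicalSpace Z] → Prop) (X : Type u) [TopologicalSpace X] :
    Type u := ↥(lambdaP P X \ Set.range (stoneCechUnit : X → StoneCech X))

open TopologicalSpace in
/-- The open subset of `λ_P X \ X` attached to an extension. -/
def uT (P : (Z : Type u) → [TopologicalSpace Z] → Prop) (T : OnePointExt X) : Opens (Lsp P X) :=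
  ⟨Subtype.val ⁻¹' T.thetaᶜ, T.isClosed_theta.isOpen_compl.preimage continuous_subtype_val⟩

section
open TopologicalSpace
variable [T35Space X] {P : (Z : Type u) → [TopologicalSpace Z] → Prop}

theorem image_uT (hProp : TopProperty P) (hG : GoodP P) (T : OnePointExt X) (hT : P T.carrier) :
    Subtype.val '' (uT P T : Set (Lsp P X)) =
      (range (stoneCechUnit : X → StoneCech X))ᶜ \ T.theta := by
  rw [P_iff hProp hG] at hT
  ext p
  constructor
  · rintro ⟨q, hq, rfl⟩
    exact ⟨q.2.2, hq⟩
  · rintro ⟨h1, h2⟩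
    have h3 : p ∈ lambdaP P X := by
      by_contra hc
      exact h2 (hT hc)
    exact ⟨⟨p, h3, h1⟩, h2, rfl⟩

theorem uT_le_iff (hProp : TopProperty P) (hG : GoodP P) (T1 T2 : OnePointExt X)
    (hT1 : P T1.carrier) (hT2 : P T2.carrier) : T1.le T2 ↔ uT P T1 ≤ uT P T2 := by
  rw [OnePointExt.le_iff]
  constructor
  · intro h x hx hx2
    exact hx (h hx2)
  · intro h p hp
    by_contra hc
    have h1 : p ∈ (range (stoneCechUnit : X → StoneCech X))ᶜ \ T1.theta := by
      refine ⟨?_, hc⟩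
      rintro ⟨x, rfl⟩
      exact T2.unit_notMem_theta x hp
    rw [← image_uT hProp hG T1 hT1] at h1
    obtain ⟨q, hq, rfl⟩ := h1
    exact h hq hp

theorem uT_surj [LocallyCompactSpace X] (hProp : TopProperty P) (hG : GoodP P)
    (hloc : LocallyP P X) (hn : ¬ P X) (O : Opens (Lsp P X)) :
    ∃ T : OnePointExt X, P T.carrier ∧ uT P T = O := by
  obtain ⟨W, hW, hWO⟩ := isOpen_induced_iff.1 O.isOpen
  have hXl := unit_mem_lambda hProp hG hloc
  obtain ⟨p0, hp0⟩ := lambda_ne_univ hG hn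
  obtain ⟨T, hT⟩ := exists_ext
    ((range (stoneCechUnit : X → StoneCech X))ᶜ \ (W ∩ lambdaP P X))
    ((isOpen_range_unit X).isClosed_compl.sdiff (hW.inter (isOpen_lambdaP P)))
    ⟨p0, by rintro ⟨x, rfl⟩; exact hp0 (hXl x), fun h => hp0 h.2⟩
    (fun x h => h.1 ⟨x, rfl⟩)
  refine ⟨T, (P_iff hProp hG T).2 ?_, ?_⟩
  · intro p hp
    rw [hT]
    exact ⟨by rintro ⟨x, rfl⟩; exact hp (hXl x), fun h => hp h.2⟩
  · ext x
    change x.1 ∉ T.theta ↔ x ∈ (O : Set (Lsp P X))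
    rw [← hWO, hT]
    constructor
    · intro h
      by_contra hc
      exact h ⟨x.2.2, fun h => hc h.1⟩
    · intro h h2
      exact h2.2 ⟨h, x.2.1⟩

theorem uT_sigma (hProp : TopProperty P) (hG : GoodP P) (T : OnePointExt X) (hT : P T.carrier) :
    CechComplete T.carrier ↔ uT P T ∈ SigmaOpens (Lsp P X) := by
  rw [T.cech_iff, ← image_uT hProp hG T hT]
  exact (IsEmbedding.subtypeVal.isSigmaCompact_iff).symm

theorem uT_comp (hProp : TopProperty P) (hG : GoodP P) (T : OnePointExt X) (hT : P T.carrier) :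
    LocallyCompactSpace T.carrier ↔ uT P T ∈ CompOpens (Lsp P X) := by
  rw [T.lc_iff, ← image_uT hProp hG T hT]
  exact (IsEmbedding.subtypeVal.isCompact_iff).symm

theorem lc_Lsp [LocallyCompactSpace X] : LocallyCompactSpace (Lsp P X) := by
  apply IsLocallyClosed.locallyCompactSpace
  rw [sdiff_eq]
  exact (isOpen_lambdaP P).isLocallyClosed.inter (isOpen_range_unit X).isClosed_compl.isLocallyClosed

theorem comp_base [LocallyCompactSpace X] (hz : StronglyZeroDimensional X) (O : Opens (Lsp P X))
    (x : Lsp P X) (hx : x ∈ O) : ∃ U ∈ CompOpens (Lsp P X), x ∈ U ∧ U ≤ O := by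
  obtain ⟨W, hW, hWO⟩ := isOpen_induced_iff.1 O.isOpen
  have hxW : x.1 ∈ W := by
    have : x ∈ (O : Set (Lsp P X)) := hx
    rw [← hWO] at this
    exact this
  obtain ⟨V, hV, hxV, hVW⟩ := hz (W ∩ lambdaP P X) (hW.inter (isOpen_lambdaP P)) x.1 ⟨hxW, x.2.1⟩
  refine ⟨⟨Subtype.val ⁻¹' V, hV.isOpen.preimage continuous_subtype_val⟩, ?_, hxV, ?_⟩
  · change IsCompact (Subtype.val ⁻¹' V)
    rw [IsEmbedding.subtypeVal.isCompact_iff]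
    have : Subtype.val '' (Subtype.val ⁻¹' V : Set (Lsp P X)) =
        V ∩ (range (stoneCechUnit : X → StoneCech X))ᶜ := by
      rw [Subtype.image_preimage_coe]
      ext p
      exact ⟨fun h => ⟨h.2, h.1.2⟩, fun h => ⟨⟨(hVW h.1).2, h.2⟩, h.1⟩⟩
    rw [this]
    exact (hV.isClosed.inter (isOpen_range_unit X).isClosed_compl).isCompact
  · intro y hy
    change y ∈ (O : Set (Lsp P X))
    rw [← hWO]
    exact (hVW hy).1

end

theorem roi_iff {X Y : Type u} [TopologicalSpace X] [TopologicalSpace Y] {α β : Type*}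
    [PartialOrder α] [PartialOrder β] (u : OnePointExt X → α) (v : OnePointExt Y → β)
    (A : Set (OnePointExt X)) (B : Set (OnePointExt Y)) (Q : Set α) (Q' : Set β)
    (hne : Nonempty (OnePointExt Y))
    (hA : ∀ T ∈ A, u T ∈ Q) (hAs : ∀ q ∈ Q, ∃ T ∈ A, u T = q)
    (hAl : ∀ T1 ∈ A, ∀ T2 ∈ A, (T1.le T2 ↔ u T1 ≤ u T2))
    (hB : ∀ T ∈ B, v T ∈ Q') (hBs : ∀ q ∈ Q', ∃ T ∈ B, v T = q)
    (hBl : ∀ T1 ∈ B, ∀ T2 ∈ B, (T1.le T2 ↔ v T1 ≤ v T2)) :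
    (∃ Δ : OnePointExt X → OnePointExt Y, RestrictedOrderIso A B Δ) ↔ Nonempty (Q ≃o Q') := by
  constructor
  · rintro ⟨Δ, h1, h2, h3⟩
    choose s hs hus using hAs
    let f : Q → Q' := fun q => ⟨v (Δ (s q.1 q.2)), hB _ (h1 _ (hs _ _))⟩
    have hf : ∀ a b, f a ≤ f b ↔ a ≤ b := by
      intro a b
      change v (Δ (s a.1 a.2)) ≤ v (Δ (s b.1 b.2)) ↔ a.1 ≤ b.1
      rw [← hBl _ (h1 _ (hs _ _)) _ (h1 _ (hs _ _)), ← h2 _ (hs _ _) _ (hs _ _),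
        hAl _ (hs _ _) _ (hs _ _), hus, hus]
    refine ⟨RelIso.ofSurjective (OrderEmbedding.ofMapLEIff f hf) ?_⟩
    rintro ⟨q, hq⟩
    obtain ⟨S, hS, rfl⟩ := hBs q hq
    obtain ⟨T, hT, hTS⟩ := h3 S hS
    rw [OnePointExt.equiv_iff] at hTS
    refine ⟨⟨u T, hA T hT⟩, Subtype.ext ?_⟩
    change v (Δ (s (u T) _)) = v S
    have hsm := hs (u T) (hA T hT)
    have e1 : v (Δ (s (u T) (hA T hT))) = v (Δ T) := by
      apply le_antisymm
      · rw [← hBl _ (h1 _ hsm) _ (h1 _ hT), ← h2 _ hsm _ hT, hAl _ hsm _ hT, hus]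
      · rw [← hBl _ (h1 _ hT) _ (h1 _ hsm), ← h2 _ hT _ hsm, hAl _ hT _ hsm, hus]
    rw [e1]
    exact le_antisymm ((hBl _ (h1 _ hT) _ hS).1 hTS.1) ((hBl _ hS _ (h1 _ hT)).1 hTS.2)
  · rintro ⟨e⟩
    classical
    choose s hs hvs using hBs
    obtain ⟨S0⟩ := hne
    let Δ : OnePointExt X → OnePointExt Y := fun T =>
      if hT : T ∈ A then s (e ⟨u T, hA T hT⟩).1 (e ⟨u T, hA T hT⟩).2 else S0
    have hΔ : ∀ T (hT : T ∈ A), Δ T = s (e ⟨u T, hA T hT⟩).1 (e ⟨u T, hA T hT⟩).2 :=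
      fun T hT => dif_pos hT
    refine ⟨Δ, ?_, ?_, ?_⟩
    · intro T hT
      rw [hΔ T hT]
      exact hs _ _
    · intro T1 hT1 T2 hT2
      rw [hΔ T1 hT1, hΔ T2 hT2, hBl _ (hs _ _) _ (hs _ _), hvs, hvs, hAl _ hT1 _ hT2]
      exact (e.le_iff_le (x := ⟨u T1, hA T1 hT1⟩) (y := ⟨u T2, hA T2 hT2⟩)).symm
    · intro S hS
      obtain ⟨T, hT, hTq⟩ := hAs _ (e.symm ⟨v S, hB S hS⟩).2
      refine ⟨T, hT, ?_⟩
      have h1 : (⟨u T, hA T hT⟩ : Q) = e.symm ⟨v S, hB S hS⟩ := Subtype.ext hTq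
      have h2 : v (Δ T) = v S := by
        rw [hΔ T hT, hvs, h1, e.apply_symm_apply]
      have h3 : Δ T ∈ B := by rw [hΔ T hT]; exact hs _ _
      rw [OnePointExt.equiv_iff, hBl _ h3 _ hS, hBl _ hS _ h3, h2]
      exact ⟨le_rfl, le_rfl⟩

/-- Let `X` and `Y` be locally compact, locally-P Tychonoff spaces not
having `P`, where `P` is either pseudocompactness or a closed hereditary Mrówka topological
property preserved under finite closed sums of subspaces.  The following are equivalent:
(1) the subspaces `λ_P X \ X` of `βX` and `λ_P Y \ Y` of `βY` are homeomorphic;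
(2) `(E_P(X), ≤)` and `(E_P(Y), ≤)` are order-isomorphic;
(3) `(E^C_P(X), ≤)` and `(E^C_P(Y), ≤)` are order-isomorphic;
(4) `(E^K_P(X), ≤)` and `(E^K_P(Y), ≤)` are order-isomorphic, provided `X` and `Y` are
moreover strongly zero-dimensional. -/
theorem stmt17 {X Y : Type u} [TopologicalSpace X] [T35Space X] [LocallyCompactSpace X]
    [TopologicalSpace Y] [T35Space Y] [LocallyCompactSpace Y]
    (P : (Z : Type u) → [TopologicalSpace Z] → Prop) (hProp : TopProperty P)
    (hP : IsPseudocompactness P ∨ (ClosedHereditary P ∧ MrowkaW P ∧ FiniteClosedSums P))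
    (hlocX : LocallyP P X) (hlocY : LocallyP P Y) (hnX : ¬ P X) (hnY : ¬ P Y) :
    ((Nonempty
        (↥(lambdaP P X \ Set.range (stoneCechUnit : X → StoneCech X)) ≃ₜ
         ↥(lambdaP P Y \ Set.range (stoneCechUnit : Y → StoneCech Y)))) ↔
      (∃ Δ : OnePointExt X → OnePointExt Y,
        RestrictedOrderIso {T : OnePointExt X | P T.carrier}
          {S : OnePointExt Y | P S.carrier} Δ)) ∧
    ((∃ Δ : OnePointExt X → OnePointExt Y,
        RestrictedOrderIso {T : OnePointExt X | P T.carrier}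
          {S : OnePointExt Y | P S.carrier} Δ) ↔
      (∃ Δ : OnePointExt X → OnePointExt Y,
        RestrictedOrderIso {T : OnePointExt X | P T.carrier ∧ CechComplete T.carrier}
          {S : OnePointExt Y | P S.carrier ∧ CechComplete S.carrier} Δ)) ∧
    (StronglyZeroDimensional X → StronglyZeroDimensional Y →
      ((∃ Δ : OnePointExt X → OnePointExt Y,
          RestrictedOrderIso {T : OnePointExt X | P T.carrier ∧ CechComplete T.carrier}
            {S : OnePointExt Y | P S.carrier ∧ CechComplete S.carrier} Δ) ↔
        (∃ Δ : OnePointExt X → OnePointExt Y,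
          RestrictedOrderIso
            {T : OnePointExt X | P T.carrier ∧ LocallyCompactSpace T.carrier}
            {S : OnePointExt Y | P S.carrier ∧ LocallyCompactSpace S.carrier} Δ))) := by

  have hG := goodP hProp hP
  have sX := uT_surj hProp hG hlocX hnX
  have sY := uT_surj hProp hG hlocY hnY
  have hneY : Nonempty (OnePointExt Y) := let ⟨T, _⟩ := sY ⊥; ⟨T⟩
  have : LocallyCompactSpace (Lsp P X) := lc_Lsp
  have : LocallyCompactSpace (Lsp P Y) := lc_Lsp
  have i2 := roi_iff (uT P) (uT P) {T : OnePointExt X | P T.carrier}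
    {S : OnePointExt Y | P S.carrier} univ univ hneY (fun _ _ => mem_univ _)
    (fun q _ => sX q) (fun T1 h1 T2 h2 => uT_le_iff hProp hG T1 T2 h1 h2)
    (fun _ _ => mem_univ _)
    (fun q _ => sY q) (fun T1 h1 T2 h2 => uT_le_iff hProp hG T1 T2 h1 h2)
  have i3 := roi_iff (uT P) (uT P) {T : OnePointExt X | P T.carrier ∧ CechComplete T.carrier}
    {S : OnePointExt Y | P S.carrier ∧ CechComplete S.carrier}
    (SigmaOpens (Lsp P X)) (SigmaOpens (Lsp P Y)) hneY
    (fun T hT => (uT_sigma hProp hG T hT.1).1 hT.2)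
    (fun q hq => by
      obtain ⟨T, hT, rfl⟩ := sX q
      exact ⟨T, ⟨hT, (uT_sigma hProp hG T hT).2 hq⟩, rfl⟩)
    (fun T1 h1 T2 h2 => uT_le_iff hProp hG T1 T2 h1.1 h2.1)
    (fun T hT => (uT_sigma hProp hG T hT.1).1 hT.2)
    (fun q hq => by
      obtain ⟨T, hT, rfl⟩ := sY q
      exact ⟨T, ⟨hT, (uT_sigma hProp hG T hT).2 hq⟩, rfl⟩)
    (fun T1 h1 T2 h2 => uT_le_iff hProp hG T1 T2 h1.1 h2.1)
  have i4 := roi_iff (uT P) (uT P)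
    {T : OnePointExt X | P T.carrier ∧ LocallyCompactSpace T.carrier}
    {S : OnePointExt Y | P S.carrier ∧ LocallyCompactSpace S.carrier}
    (CompOpens (Lsp P X)) (CompOpens (Lsp P Y)) hneY
    (fun T hT => (uT_comp hProp hG T hT.1).1 hT.2)
    (fun q hq => by
      obtain ⟨T, hT, rfl⟩ := sX q
      exact ⟨T, ⟨hT, (uT_comp hProp hG T hT).2 hq⟩, rfl⟩)
    (fun T1 h1 T2 h2 => uT_le_iff hProp hG T1 T2 h1.1 h2.1)
    (fun T hT => (uT_comp hProp hG T hT.1).1 hT.2)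
    (fun q hq => by
      obtain ⟨T, hT, rfl⟩ := sY q
      exact ⟨T, ⟨hT, (uT_comp hProp hG T hT).2 hq⟩, rfl⟩)
    (fun T1 h1 T2 h2 => uT_le_iff hProp hG T1 T2 h1.1 h2.1)
  have j2 : Nonempty (Lsp P X ≃ₜ Lsp P Y) ↔
      Nonempty ((univ : Set (TopologicalSpace.Opens (Lsp P X))) ≃o
        (univ : Set (TopologicalSpace.Opens (Lsp P Y)))) := by
    constructor
    · rintro ⟨h⟩
      exact opens_iso_of_homeo h univ univ fun O => by simp
    · rintro ⟨e⟩
      exact homeo_of_opens_iso ((OrderIso.Set.univ.symm.trans e).trans OrderIso.Set.univ)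
  have j3 : Nonempty (Lsp P X ≃ₜ Lsp P Y) ↔
      Nonempty (SigmaOpens (Lsp P X) ≃o SigmaOpens (Lsp P Y)) := by
    constructor
    · rintro ⟨h⟩
      exact sigma_iso_of_homeo h
    · rintro ⟨e⟩
      obtain ⟨e'⟩ := opens_iso_of_base (goodBase_sigma (Lsp P X)) (goodBase_sigma (Lsp P Y)) e
        (cWayBelow_iff e)
      exact homeo_of_opens_iso e'
  refine ⟨j2.trans i2.symm, i2.trans (j2.symm.trans (j3.trans i3.symm)), fun zX zY => ?_⟩
  have j4 : Nonempty (Lsp P X ≃ₜ Lsp P Y) ↔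
      Nonempty (CompOpens (Lsp P X) ≃o CompOpens (Lsp P Y)) := by
    constructor
    · rintro ⟨h⟩
      exact comp_iso_of_homeo h
    · rintro ⟨e⟩
      obtain ⟨e'⟩ := opens_iso_of_base (goodBase_comp (Lsp P X) (comp_base zX))
        (goodBase_comp (Lsp P Y) (comp_base zY)) e (fun U V => e.le_iff_le.symm)
      exact homeo_of_opens_iso e'
  exact i3.trans (j3.symm.trans (j4.trans i4.symm))
end

section
/- Let X be a Tychonoff locally-P space not having P, where P is either pseudocompactness or a closed hereditary Mrówka topological property preserved under finite closed sums of subspaces. Then (E_P(X), ≤) is a lattice which is also a complete upper semilattice, i.e., every pair of elements has a least upper bound and a greatest lower bound, and every nonempty subset has a least upper bound. Moreover, (E_P(X), ≤) is a complete lattice if and only if X is locally compact. -/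
open Set Topology Filter

universe u

variable {X : Type u} [TopologicalSpace X]

namespace OPE

lemma ps_iff {Z : Type u} [TopologicalSpace Z] {A : Set Z} :
    Pseudocompact A ↔ ∀ f : Z → ℝ, ContinuousOn f A → ∃ M, ∀ z ∈ A, |f z| ≤ M := by
  classical
  constructor
  · intro h f hf
    obtain ⟨M, hM⟩ := h (A.domRestrict f) (continuousOn_iff_continuous_domRestrict.1 hf)
    exact ⟨M, fun z hz => hM ⟨z, hz⟩⟩
  · intro h f hf
    obtain ⟨M, hM⟩ := h (fun z => if hz : z ∈ A then f ⟨z, hz⟩ else 0) (by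
      rw [continuousOn_iff_continuous_domRestrict]
      convert hf using 1
      ext z
      simp)
    refine ⟨M, fun z => ?_⟩
    have := hM z.1 z.2
    simpa using this

lemma ps_regClosed {Z : Type u} [TopologicalSpace Z] [T35Space Z] (hZ : Pseudocompact Z)
    {O : Set Z} (hO : IsOpen O) : Pseudocompact (closure O) := by
  classical
  rw [ps_iff]
  intro f₀ hf₀
  by_contra hcon
  push Not at hcon
  obtain ⟨f, hf, hcon⟩ : ∃ f : Z → ℝ, ContinuousOn f (closure O) ∧
      ∀ M, ∃ z ∈ closure O, M < f z := ⟨fun z => |f₀ z|, hf₀.abs, hcon⟩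
  have hcon2 : ∀ M, ∃ z ∈ O, M < f z := by
    intro M
    obtain ⟨z, hz, hM⟩ := hcon M
    have h1 : ∀ᶠ y in 𝓝[closure O] z, M < f y := (hf z hz).eventually (lt_mem_nhds hM)
    obtain ⟨N, hN, hNz, hNs⟩ := mem_nhdsWithin.1 h1
    obtain ⟨y, hyN, hyO⟩ := mem_closure_iff.1 hz N hN hNz
    exact ⟨y, hyO, hNs ⟨hyN, subset_closure hyO⟩⟩
  have hWo : ∀ n : ℕ, IsOpen (O ∩ f ⁻¹' Ioi (n : ℝ)) := fun n =>
    (hf.mono subset_closure).isOpen_inter_preimage hO isOpen_Ioi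
  choose x hxO hxf using fun n : ℕ => hcon2 n
  have hh : ∀ n : ℕ, ∃ h : Z → ℝ, Continuous h ∧ (∀ z, 0 ≤ h z) ∧ h (x n) = n ∧
      ∀ z, h z ≠ 0 → z ∈ O ∩ f ⁻¹' Ioi (n : ℝ) := by
    intro n
    obtain ⟨g, hg, hgx, hgK⟩ := CompletelyRegularSpace.completely_regular (x n)
      (O ∩ f ⁻¹' Ioi (n : ℝ))ᶜ (hWo n).isClosed_compl (by
        intro h; exact h ⟨hxO n, hxf n⟩)
    refine ⟨fun z => n * (1 - (g z : ℝ)), by fun_prop, fun z => ?_, by simp [hgx], fun z hz => ?_⟩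
    · have := (g z).2.2
      exact mul_nonneg (Nat.cast_nonneg n) (by linarith)
    · by_contra hz2
      apply hz
      have : g z = 1 := hgK hz2
      simp [this]
  choose h hc h0 hx hs using hh
  have hlf : LocallyFinite fun n => Function.support (h n) := by
    intro y
    by_cases hy : y ∈ closure O
    · have h1 : ∀ᶠ z in 𝓝[closure O] y, f z < f y + 1 :=
        (hf y hy).eventually (gt_mem_nhds (by linarith))
      obtain ⟨N, hN, hNz, hNs⟩ := mem_nhdsWithin.1 h1
      refine ⟨N, hN.mem_nhds hNz, ?_⟩
      obtain ⟨k, hk⟩ := exists_nat_gt (f y + 1)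
      refine (Set.finite_lt_nat k).subset ?_
      rintro n ⟨z, hz, hzN⟩
      have h2 := hs n z hz
      have h3 : f z < f y + 1 := hNs ⟨hzN, subset_closure h2.1⟩
      have h4 : (n : ℝ) < f z := h2.2
      have : (n : ℝ) < k := by linarith
      exact_mod_cast this
    · refine ⟨(closure O)ᶜ, isClosed_closure.isOpen_compl.mem_nhds hy, ?_⟩
      convert Set.finite_empty
      rw [Set.eq_empty_iff_forall_notMem]
      rintro n ⟨z, hz, hzN⟩
      exact hzN (subset_closure (hs n z hz).1)
  obtain ⟨M, hM⟩ := hZ (fun z => ∑ᶠ n, h n z) (continuous_finsum hc hlf)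
  obtain ⟨k, hk⟩ := exists_nat_gt M
  have h5 : h k (x k) ≤ ∑ᶠ n, h n (x k) :=
    single_le_finsum k (hlf.point_finite (x k)) (fun n => h0 n (x k))
  have h6 := le_trans (le_abs_self _) (hM (x k))
  rw [hx] at h5
  linarith

def Sm (P : (Z : Type u) → [TopologicalSpace Z] → Prop) {X : Type u} [TopologicalSpace X]
    (A : Set X) : Prop := ∃ V, IsOpen V ∧ A ⊆ V ∧ P (closure V)

abbrev Hyp (P : (Z : Type u) → [TopologicalSpace Z] → Prop) : Prop :=
  IsPseudocompactness P ∨ (ClosedHereditary P ∧ MrowkaW P ∧ FiniteClosedSums P)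

lemma sm_empty {P : (Z : Type u) → [TopologicalSpace Z] → Prop} (hP : Hyp P) {X : Type u}
    [TopologicalSpace X] : Sm P (∅ : Set X) := by
  refine ⟨∅, isOpen_empty, subset_rfl, ?_⟩
  have : IsEmpty (closure (∅ : Set X)) := by simp
  rcases hP with hP | ⟨-, -, hP⟩
  · rw [hP]
    exact fun f _ => ⟨0, fun z => (IsEmpty.false z).elim⟩
  · have : T2Space (closure (∅ : Set X)) := ⟨fun z => (IsEmpty.false z).elim⟩
    exact hP _ 0 (fun _ => ∅) (by simp) (fun i => i.elim0)
      (by ext z; exact (IsEmpty.false z).elim)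

/-- homeomorphism onto a set through an embedding -/
lemma P_of_emb {P : (Z : Type u) → [TopologicalSpace Z] → Prop} (hProp : TopProperty P)
    {Z W : Type u} [TopologicalSpace Z] [TopologicalSpace W] {k : Z → W} (hk : IsEmbedding k)
    {A : Set W} (hA : range k = A) : P Z ↔ P A := by
  subst hA
  exact ⟨hProp _ _ hk.toHomeomorph, hProp _ _ hk.toHomeomorph.symm⟩

lemma sm_union {P : (Z : Type u) → [TopologicalSpace Z] → Prop} (hProp : TopProperty P)
    (hP : Hyp P) {X : Type u} [TopologicalSpace X] [T2Space X] {A B : Set X}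
    (hA : Sm P A) (hB : Sm P B) : Sm P (A ∪ B) := by
  obtain ⟨V, hV, hAV, hPV⟩ := hA
  obtain ⟨W, hW, hBW, hPW⟩ := hB
  refine ⟨V ∪ W, hV.union hW, union_subset_union hAV hBW, ?_⟩
  rcases hP with hP | ⟨-, -, hP⟩
  · rw [hP, ps_iff] at *
    intro f hf
    rw [closure_union] at *
    obtain ⟨M, hM⟩ := hPV f (hf.mono subset_union_left)
    obtain ⟨N, hN⟩ := hPW f (hf.mono subset_union_right)
    refine ⟨max M N, ?_⟩
    rintro z (hz | hz)
    · exact (hM z hz).trans (le_max_left _ _)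
    · exact (hN z hz).trans (le_max_right _ _)
  · have key : ∀ C : Set X, C ⊆ V ∪ W → P (closure C) →
        P (Subtype.val ⁻¹' (closure C) : Set (closure (V ∪ W))) := by
      intro C hC h
      refine (P_of_emb hProp (k := Set.inclusion (closure_mono hC))
        (IsEmbedding.inclusion _) ?_).1 h
      rw [Set.range_inclusion]; rfl
    refine hP _ 2 ![Subtype.val ⁻¹' (closure V), Subtype.val ⁻¹' (closure W)] ?_ ?_ ?_
    · intro i
      fin_cases i <;> exact isClosed_closure.preimage continuous_subtype_val
    · intro i
      fin_cases i
      · exact key V subset_union_left hPV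
      · exact key W subset_union_right hPW
    · rw [Set.eq_univ_iff_forall]
      rintro ⟨z, hz⟩
      rw [closure_union] at hz
      rw [mem_iUnion]
      rcases hz with hz | hz
      · exact ⟨0, hz⟩
      · exact ⟨1, hz⟩

/-- the filter of co-small sets -/
def G0 {P : (Z : Type u) → [TopologicalSpace Z] → Prop} (hProp : TopProperty P)
    (hP : Hyp P) (X : Type u) [TopologicalSpace X] [T2Space X] : Filter X where
  sets := {U | Sm P Uᶜ}
  univ_sets := by
    have := sm_empty hP (X := X)
    simpa using this
  sets_of_superset := by
    rintro U U' ⟨V, hV, h1, h2⟩ hU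
    exact ⟨V, hV, (compl_subset_compl.2 hU).trans h1, h2⟩
  inter_sets := by
    intro U U' h1 h2
    simp only [mem_ofPred_eq, compl_inter] at *
    exact sm_union hProp hP h1 h2

lemma mem_G0 {P : (Z : Type u) → [TopologicalSpace Z] → Prop} {hProp : TopProperty P}
    {hP : Hyp P} {X : Type u} [TopologicalSpace X] [T2Space X] {U : Set X} :
    U ∈ G0 hProp hP X ↔ Sm P Uᶜ := Iff.rfl

/-- trace filter -/
def tr {X : Type u} [TopologicalSpace X] (Y : OnePointExt X) : Filter X := comap Y.ι (𝓝 Y.pt)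

section
variable {X : Type u} [TopologicalSpace X]

lemma ne_pt (Y : OnePointExt X) (x : X) : Y.ι x ≠ Y.pt := by
  have : Y.ι x ∈ range Y.ι := ⟨x, rfl⟩
  rw [Y.range_eq] at this
  exact this

lemma cases_pt (Y : OnePointExt X) (y : Y.carrier) : y = Y.pt ∨ ∃ x, Y.ι x = y := by
  by_cases h : y = Y.pt
  · exact Or.inl h
  · right
    have : y ∈ range Y.ι := by rw [Y.range_eq]; exact h
    exact this

lemma tr_neBot (Y : OnePointExt X) : (tr Y).NeBot := by
  refine comap_neBot_iff.2 fun t ht => ?_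
  obtain ⟨_, hy, x, rfl⟩ := mem_closure_iff_nhds.1 (Y.dense Y.pt) t ht
  exact ⟨x, hy⟩

lemma tr_disj (Y : OnePointExt X) (x : X) : Disjoint (𝓝 x) (tr Y) := by
  rw [Y.emb.nhds_eq_comap]
  exact disjoint_comap (disjoint_nhds_nhds.2 (ne_pt Y x))

lemma openEmb (Y : OnePointExt X) : IsOpenEmbedding Y.ι :=
  ⟨Y.emb, by rw [Y.range_eq]; exact isOpen_compl_singleton⟩

lemma le_iff (Y1 Y2 : OnePointExt X) : Y1.le Y2 ↔ tr Y2 ≤ tr Y1 := by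
  classical
  constructor
  · rintro ⟨f, hf, hfx⟩
    have hne := tr_neBot Y2
    have hcomp : f ∘ Y2.ι = Y1.ι := funext hfx
    have ht : Tendsto Y1.ι (tr Y2) (𝓝 (f Y2.pt)) := by
      rw [← hcomp]
      exact (hf.tendsto _).comp tendsto_comap
    rcases cases_pt Y1 (f Y2.pt) with h | ⟨x, h⟩
    · rw [h] at ht
      exact ht.le_comap
    · rw [← h] at ht
      have h1 : tr Y2 ≤ 𝓝 x := by
        rw [Y1.emb.nhds_eq_comap]; exact ht.le_comap
      have h2 := (tr_disj Y2 x).mono_left h1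
      exact (hne.ne (disjoint_self.1 h2)).elim
  · intro h
    have hex : ∀ y : Y2.carrier, ∃ z : Y1.carrier,
        (y = Y2.pt → z = Y1.pt) ∧ ∀ x, y = Y2.ι x → z = Y1.ι x := by
      intro y
      rcases cases_pt Y2 y with hy | ⟨x, rfl⟩
      · exact ⟨Y1.pt, fun _ => rfl, fun x hx => (ne_pt Y2 x (hx ▸ hy)).elim⟩
      · exact ⟨Y1.ι x, fun hx => (ne_pt Y2 x hx).elim,
          fun x' hx => by rw [Y2.emb.injective hx]⟩
    choose f hf1 hf2 using hex
    have hfx : ∀ x, f (Y2.ι x) = Y1.ι x := fun x => hf2 _ x rfl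
    refine ⟨f, ?_, hfx⟩
    rw [continuous_iff_continuousAt]
    intro y
    rcases cases_pt Y2 y with rfl | ⟨x, rfl⟩
    · intro V hV
      rw [hf1 _ rfl] at hV
      have h1 : Y1.ι ⁻¹' V ∈ tr Y2 := h (preimage_mem_comap hV)
      obtain ⟨V2, hV2, hs⟩ := h1
      refine mem_map.2 (mem_of_superset hV2 ?_)
      intro z hz
      rcases cases_pt Y2 z with rfl | ⟨x, rfl⟩
      · show f _ ∈ V
        rw [hf1 _ rfl]; exact mem_of_mem_nhds hV
      · show f _ ∈ V
        rw [hfx]; exact hs hz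
    · rw [ContinuousAt, ← (openEmb Y2).map_nhds_eq, tendsto_map'_iff, hfx]
      have : f ∘ Y2.ι = Y1.ι := funext hfx
      rw [this]
      exact Y1.emb.continuous.tendsto x

/-- completely regular core -/
def core (G : Filter X) : Filter X where
  sets := {U | ∃ g : X → ℝ, Continuous g ∧ Tendsto g G (𝓝 0) ∧ ∀ x, g x < 1 → x ∈ U}
  univ_sets := ⟨fun _ => 0, continuous_const, tendsto_const_nhds, fun _ _ => trivial⟩
  sets_of_superset := by
    rintro U V ⟨g, h1, h2, h3⟩ h
    exact ⟨g, h1, h2, fun x hx => h (h3 x hx)⟩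
  inter_sets := by
    rintro U V ⟨g, h1, h2, h3⟩ ⟨g', h1', h2', h3'⟩
    refine ⟨fun x => max (g x) (g' x), h1.max h1', ?_, fun x hx => ?_⟩
    · simpa using h2.max h2'
    · rw [max_lt_iff] at hx
      exact ⟨h3 x hx.1, h3' x hx.2⟩

lemma mem_core {G : Filter X} {U : Set X} : U ∈ core G ↔
    ∃ g : X → ℝ, Continuous g ∧ Tendsto g G (𝓝 0) ∧ ∀ x, g x < 1 → x ∈ U := Iff.rfl

lemma le_core (G : Filter X) : G ≤ core G := by
  rintro U ⟨g, h1, h2, h3⟩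
  filter_upwards [h2.eventually (gt_mem_nhds one_pos)] with x hx using h3 x hx

lemma core_mono {G G' : Filter X} (h : G ≤ G') : core G ≤ core G' := by
  rintro U ⟨g, h1, h2, h3⟩
  exact ⟨g, h1, h2.mono_left h, h3⟩

lemma core_mem_lt {G : Filter X} {g : X → ℝ} (h1 : Continuous g) (h2 : Tendsto g G (𝓝 0))
    {ε : ℝ} (hε : 0 < ε) : {x | g x < ε} ∈ core G := by
  refine ⟨fun x => g x / ε, by fun_prop, ?_, fun x hx => ?_⟩
  · simpa using h2.div_const ε
  · exact (div_lt_one hε).1 hx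

lemma core_tendsto {G : Filter X} {g : X → ℝ} (h1 : Continuous g) (h2 : Tendsto g G (𝓝 0)) :
    Tendsto g (core G) (𝓝 0) := by
  rw [Metric.tendsto_nhds]
  intro ε hε
  have h := core_mem_lt h1.abs (by simpa using h2.abs) hε
  filter_upwards [h] with x hx
  simpa using hx

lemma core_tr (Y : OnePointExt X) : core (tr Y) ≤ tr Y := by
  rintro U ⟨V, hV, hVU⟩
  obtain ⟨V', hV'V, hV', hp⟩ := mem_nhds_iff.1 hV
  obtain ⟨g, hg, hgx, hgK⟩ := CompletelyRegularSpace.completely_regular Y.pt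
      V'ᶜ hV'.isClosed_compl (fun h => h hp)
  refine ⟨fun x => (g (Y.ι x) : ℝ), ?_, ?_, fun x hx => ?_⟩
  · exact continuous_subtype_val.comp (hg.comp Y.emb.continuous)
  · have h1 : Tendsto (fun y => (g y : ℝ)) (𝓝 Y.pt) (𝓝 (g Y.pt : ℝ)) :=
      (continuous_subtype_val.comp hg).tendsto _
    rw [hgx] at h1
    exact h1.comp tendsto_comap
  · apply hVU
    apply hV'V
    by_contra hc
    have : g (Y.ι x) = 1 := hgK hc
    simp [this] at hx

lemma core_disj [T35Space X] {G : Filter X} {x : X} (h : Disjoint (𝓝 x) G) :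
    Disjoint (𝓝 x) (core G) := by
  obtain ⟨V, hV, W, hW, hd⟩ := Filter.disjoint_iff.1 h
  obtain ⟨V', hV'V, hV', hp⟩ := mem_nhds_iff.1 hV
  obtain ⟨g, hg, hgx, hgK⟩ := CompletelyRegularSpace.completely_regular x
      V'ᶜ hV'.isClosed_compl (fun h => h hp)
  have hc : Continuous fun y => 1 - (g y : ℝ) := by fun_prop
  have ht : Tendsto (fun y => 1 - (g y : ℝ)) G (𝓝 0) := by
    refine tendsto_const_nhds.congr' ?_
    filter_upwards [hW] with y hy
    have : g y = 1 := hgK (fun hy' => hd.le_bot ⟨hV'V hy', hy⟩)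
    simp [this]
  refine Filter.disjoint_iff.2 ⟨{y | 1 / 2 < 1 - (g y : ℝ)}, ?_, _,
    core_mem_lt hc ht (ε := 1 / 2) (by norm_num), ?_⟩
  · exact (isOpen_lt continuous_const hc).mem_nhds (by simp [hgx]; norm_num)
  · rw [Set.disjoint_left]
    intro y h1 h2
    exact lt_asymm (show 1 / 2 < 1 - (g y : ℝ) from h1) h2

/-- topology on `Option X` from a filter -/
@[reducible]
def optTop (F : Filter X) : TopologicalSpace (Option X) where
  IsOpen s := IsOpen (some ⁻¹' s) ∧ (none ∈ s → some ⁻¹' s ∈ F)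
  isOpen_univ := ⟨isOpen_univ, fun _ => univ_mem⟩
  isOpen_inter := fun s t hs ht => ⟨hs.1.inter ht.1, fun h => inter_mem (hs.2 h.1) (ht.2 h.2)⟩
  isOpen_sUnion := fun S hS => by
    refine ⟨?_, ?_⟩
    · rw [preimage_sUnion]
      exact isOpen_biUnion fun t ht => (hS t ht).1
    · rintro ⟨t, ht, hn⟩
      exact mem_of_superset ((hS t ht).2 hn) (preimage_mono (subset_sUnion_of_mem ht))

lemma isOpen_opt {F : Filter X} {s : Set (Option X)} : IsOpen[optTop F] s ↔
    IsOpen (some ⁻¹' s) ∧ (none ∈ s → some ⁻¹' s ∈ F) := Iff.rfl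

lemma cont_opt {F : Filter X} {W : Type*} [TopologicalSpace W] {h : Option X → W}
    (h1 : Continuous (h ∘ some)) (h2 : Tendsto (h ∘ some) F (𝓝 (h none))) :
    @Continuous _ _ (optTop F) _ h := by
  let _ := optTop F
  refine ⟨fun V hV => isOpen_opt.2 ⟨hV.preimage h1, fun hn => ?_⟩⟩
  exact h2 (hV.mem_nhds hn)

lemma opt_emb (F : Filter X) : @IsOpenEmbedding _ _ _ (optTop F) (some : X → Option X) := by
  let _ := optTop F
  refine IsOpenEmbedding.of_continuous_injective_isOpenMap ⟨fun V hV => hV.1⟩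
    (Option.some_injective X) ?_
  intro U hU
  refine isOpen_opt.2 ⟨?_, fun h => ?_⟩
  · rwa [preimage_image_eq _ (Option.some_injective X)]
  · simp at h

lemma opt_t35 [T35Space X] {G : Filter X} (hd : ∀ x, Disjoint (𝓝 x) G) :
    @T35Space _ (optTop (core G)) := by
  let _ := optTop (core G)
  have hcr : CompletelyRegularSpace (Option X) := by
    refine ⟨fun x K hK hx => ?_⟩
    have hKo := isOpen_opt.1 hK.isOpen_compl
    cases x with
    | none =>
      obtain ⟨g, h1, h2, h3⟩ := mem_core.1 (hKo.2 hx)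
      let g' : Option X → ℝ := fun o => o.elim 0 g
      have hg' : Continuous g' := cont_opt h1 (core_tendsto h1 h2)
      refine ⟨fun o => Set.projIcc (0 : ℝ) 1 zero_le_one (g' o), by fun_prop, ?_, ?_⟩
      · exact Set.projIcc_left (h := zero_le_one (α := ℝ))
      · intro o ho
        refine Set.projIcc_of_right_le _ ?_
        cases o with
        | none => exact (hx ho).elim
        | some y =>
          by_contra hc
          exact h3 y (not_le.1 hc) ho
    | some x =>
      obtain ⟨V, hV, W, hW, hVW⟩ := Filter.disjoint_iff.1 (core_disj (hd x))
      have hN : V ∩ some ⁻¹' Kᶜ ∈ 𝓝 x := inter_mem hV (hKo.1.mem_nhds hx)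
      obtain ⟨V', hV'V, hV', hp⟩ := mem_nhds_iff.1 hN
      obtain ⟨g, hg, hgx, hgK⟩ := CompletelyRegularSpace.completely_regular x
        V'ᶜ hV'.isClosed_compl (fun h => h hp)
      refine ⟨fun o => o.elim 1 g, cont_opt hg ?_, hgx, ?_⟩
      · refine tendsto_const_nhds.congr' ?_
        filter_upwards [hW] with y hy
        exact (hgK (fun hy' => hVW.le_bot ⟨(hV'V hy').1, hy⟩)).symm
      · intro o ho
        cases o with
        | none => rfl
        | some y => exact hgK (fun hy' => (hV'V hy').2 ho)
  have ht0 : T0Space (Option X) := by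
    have hT1 : T1Space (Option X) := by
      refine ⟨fun o => ⟨isOpen_opt.2 ?_⟩⟩
      cases o with
      | none =>
        refine ⟨?_, fun h => (h rfl).elim⟩
        convert isOpen_univ
        ext; simp
      | some x =>
        have : (some ⁻¹' {some x}ᶜ : Set X) = {x}ᶜ := by ext; simp
        rw [this]
        refine ⟨isOpen_compl_singleton, fun _ => ?_⟩
        obtain ⟨V, hV, W, hW, hVW⟩ := Filter.disjoint_iff.1 (core_disj (hd x))
        refine mem_of_superset hW ?_
        rintro y hy rfl
        exact hVW.le_bot ⟨mem_of_mem_nhds hV, hy⟩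
    infer_instance
  exact { hcr, ht0 with }

lemma opt_tr (G : Filter X) :
    comap some (@nhds _ (optTop (core G)) none) = core G := by
  let _ := optTop (core G)
  ext U
  constructor
  · rintro ⟨V, hV, hVU⟩
    obtain ⟨V', hV'V, hV', hp⟩ := mem_nhds_iff.1 hV
    exact mem_of_superset (hV'.2 hp) ((preimage_mono hV'V).trans hVU)
  · rintro ⟨g, h1, h2, h3⟩
    have hpre : (some ⁻¹' (insert none (some '' {x | g x < 1})) : Set X) = {x | g x < 1} := by
      ext; simp
    refine ⟨insert none (some '' {x | g x < 1}), IsOpen.mem_nhds (isOpen_opt.2 ?_)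
      (mem_insert _ _), ?_⟩
    · rw [hpre]
      exact ⟨isOpen_lt h1 continuous_const, fun _ => core_mem_lt h1 h2 one_pos⟩
    · rw [hpre]
      exact h3

lemma exists_ext [T35Space X] {G : Filter X} (hG : G.NeBot) (hd : ∀ x, Disjoint (𝓝 x) G) :
    ∃ Y : OnePointExt X, tr Y = core G := by
  have hne : (core G).NeBot := hG.mono (le_core G)
  have hemb : @IsEmbedding X (Option X) _ (optTop (core G)) some := by
    let _ := optTop (core G)
    exact (opt_emb (core G)).isEmbedding
  refine ⟨{ carrier := Option X
            top := optTop (core G)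
            t35 := opt_t35 hd
            ι := some
            emb := hemb
            pt := none
            range_eq := ?_
            dense := ?_ }, opt_tr G⟩
  · ext o; cases o <;> simp
  · let _ := optTop (core G)
    intro o
    cases o with
    | some x => exact subset_closure ⟨x, rfl⟩
    | none =>
      rw [mem_closure_iff]
      intro V hV hn
      obtain ⟨x, hx⟩ := hne.nonempty_of_mem (hV.2 hn)
      exact ⟨some x, hx, x, rfl⟩

lemma P_iff {P : (Z : Type u) → [TopologicalSpace Z] → Prop} (hProp : TopProperty P)
    (hP : Hyp P) [T2Space X] (Y : OnePointExt X) :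
    P Y.carrier ↔ G0 hProp hP X ≤ tr Y := by
  constructor
  · rintro h U ⟨V, hV, hVU⟩
    obtain ⟨V', hV'V, hV', hp⟩ := mem_nhds_iff.1 hV
    obtain ⟨g, hg, hgx, hgK⟩ := CompletelyRegularSpace.completely_regular Y.pt
      V'ᶜ hV'.isClosed_compl (fun h => h hp)
    have hgc : Continuous fun y => (g y : ℝ) := continuous_subtype_val.comp hg
    let O : Set Y.carrier := {y | 1 / 2 < (g y : ℝ)}
    have hO : IsOpen O := isOpen_lt continuous_const hgc
    have hptO : Y.pt ∉ closure O := by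
      intro hc
      have h1 : closure O ⊆ {y | 1 / 2 ≤ (g y : ℝ)} :=
        closure_minimal (fun y (hy : 1 / 2 < (g y : ℝ)) => show 1 / 2 ≤ (g y : ℝ) from hy.le) (isClosed_le continuous_const hgc)
      have h2 : 1 / 2 ≤ (g Y.pt : ℝ) := h1 hc
      rw [hgx] at h2
      norm_num at h2
    have hPO : P (closure O) := by
      rcases hP with hP | ⟨hP, -, -⟩
      · rw [hP] at *
        exact ps_regClosed h hO
      · exact hP _ h _ isClosed_closure
    refine ⟨Y.ι ⁻¹' O, hO.preimage Y.emb.continuous, ?_, ?_⟩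
    · intro x hx
      have : g (Y.ι x) = 1 := hgK (fun h => hx (hVU (hV'V h)))
      show 1 / 2 < (g (Y.ι x) : ℝ)
      rw [this]; norm_num
    · refine (P_of_emb hProp (k := fun z : closure (Y.ι ⁻¹' O) => Y.ι z.1)
        (Y.emb.comp IsEmbedding.subtypeVal) ?_).2 hPO
      rw [← (openEmb Y).isOpenMap.preimage_closure_eq_closure_preimage Y.emb.continuous]
      ext y
      constructor
      · rintro ⟨⟨x, hx⟩, rfl⟩
        exact hx
      · intro hy
        rcases cases_pt Y y with rfl | ⟨x, rfl⟩
        · exact (hptO hy).elim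
        · exact ⟨⟨x, hy⟩, rfl⟩
  · intro h
    have h' : ∀ V : Set Y.carrier, IsOpen V → Y.pt ∈ V → Sm P (Y.ι ⁻¹' V)ᶜ := fun V hV hp =>
      h (preimage_mem_comap (hV.mem_nhds hp))
    clear h
    rcases hP with hP | ⟨hP, hM, -⟩
    · rw [hP]
      intro f hf
      obtain ⟨V, hV, hsub, hPV⟩ := h' {y | |f y| < |f Y.pt| + 1}
        (isOpen_lt hf.abs continuous_const) (by simp)
      rw [hP, ps_iff] at hPV
      obtain ⟨M, hM⟩ := hPV (f ∘ Y.ι) (hf.comp Y.emb.continuous).continuousOn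
      refine ⟨max M (|f Y.pt| + 1), fun y => ?_⟩
      by_cases hy : |f y| < |f Y.pt| + 1
      · exact hy.le.trans (le_max_right _ _)
      · rcases cases_pt Y y with rfl | ⟨x, rfl⟩
        · exact (hy (by linarith)).elim
        · exact (hM x (subset_closure (hsub hy))).trans (le_max_left _ _)
    · refine hM Y.carrier Y.pt {b | IsOpen b ∧ Y.pt ∈ b} (fun b hb => hb)
        (fun V hV hp => ⟨V, ⟨hV, hp⟩, subset_rfl⟩) ?_
      rintro b ⟨hb, hpb⟩
      obtain ⟨V, hV, hsub, hPV⟩ := h' b hb hpb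
      have hcl : IsClosed {z : closure V | Y.ι z.1 ∈ bᶜ} :=
        hb.isClosed_compl.preimage (Y.emb.continuous.comp continuous_subtype_val)
      refine (P_of_emb hProp
        (k := fun z : {z : closure V | Y.ι z.1 ∈ bᶜ} => Y.ι z.1.1)
        (Y.emb.comp (IsEmbedding.subtypeVal.comp IsEmbedding.subtypeVal)) ?_).1 (hP _ hPV _ hcl)
      ext y
      constructor
      · rintro ⟨⟨⟨x, hx⟩, hx'⟩, rfl⟩
        exact hx'
      · intro hy
        rcases cases_pt Y y with rfl | ⟨x, rfl⟩
        · exact (hy hpb).elim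
        · exact ⟨⟨⟨x, subset_closure (hsub hy)⟩, hy⟩, rfl⟩

lemma G0_neBot {P : (Z : Type u) → [TopologicalSpace Z] → Prop} (hProp : TopProperty P)
    (hP : Hyp P) [T2Space X] (hnP : ¬ P X) : (G0 hProp hP X).NeBot := by
  rw [neBot_iff]
  intro h
  rw [← empty_mem_iff_bot, mem_G0] at h
  obtain ⟨V, hV, hs, hPV⟩ := h
  apply hnP
  have hc : closure V = univ := by
    rw [compl_empty, univ_subset_iff] at hs
    rw [hs, closure_univ]
  rw [hc] at hPV
  exact hProp _ _ (Homeomorph.Set.univ X) hPV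

lemma G0_disj {P : (Z : Type u) → [TopologicalSpace Z] → Prop} (hProp : TopProperty P)
    (hP : Hyp P) [T2Space X] (hloc : LocallyP P X) (x : X) :
    Disjoint (𝓝 x) (G0 hProp hP X) := by
  obtain ⟨U, hU, hx, hPU⟩ := hloc x
  refine Filter.disjoint_iff.2 ⟨U, hU.mem_nhds hx, Uᶜ, ?_, disjoint_compl_right⟩
  exact mem_G0.2 ⟨U, hU, by rw [compl_compl], hPU⟩

lemma exists_extP {P : (Z : Type u) → [TopologicalSpace Z] → Prop} (hProp : TopProperty P)
    (hP : Hyp P) [T35Space X] (hnP : ¬ P X) {G : Filter X} (hG : G0 hProp hP X ≤ G)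
    (hd : ∀ x, Disjoint (𝓝 x) G) : ∃ Y : OnePointExt X, P Y.carrier ∧ tr Y = core G := by
  obtain ⟨Y, hY⟩ := exists_ext ((G0_neBot hProp hP hnP).mono hG) hd
  refine ⟨Y, ?_, hY⟩
  rw [P_iff hProp hP, hY]
  exact hG.trans (le_core G)

lemma sup_exists {P : (Z : Type u) → [TopologicalSpace Z] → Prop} (hProp : TopProperty P)
    (hP : Hyp P) [T35Space X] (hnP : ¬ P X) (S : Set (OnePointExt X))
    (hS : ∀ T ∈ S, P T.carrier) (hne : S.Nonempty) :
    ∃ Y : OnePointExt X, P Y.carrier ∧ (∀ T ∈ S, T.le Y) ∧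
      ∀ W : OnePointExt X, P W.carrier → (∀ T ∈ S, T.le W) → Y.le W := by
  obtain ⟨T0, hT0⟩ := hne
  obtain ⟨Y, hPY, hY⟩ := exists_extP hProp hP hnP (G := ⨅ T ∈ S, tr T)
    (le_iInf₂ fun T hT => (P_iff hProp hP T).1 (hS T hT))
    (fun x => (tr_disj T0 x).mono_right (iInf₂_le T0 hT0))
  refine ⟨Y, hPY, fun T hT => ?_, fun W _ hW => ?_⟩
  · rw [le_iff, hY]
    exact (core_mono (iInf₂_le T hT)).trans (core_tr T)
  · rw [le_iff, hY]
    exact (le_iInf₂ fun T hT => (le_iff _ _).1 (hW T hT)).trans (le_core _)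

lemma inf_exists {P : (Z : Type u) → [TopologicalSpace Z] → Prop} (hProp : TopProperty P)
    (hP : Hyp P) [T35Space X] (hnP : ¬ P X) (S : Set (OnePointExt X))
    (hS : ∀ T ∈ S, P T.carrier) (hne : S.Nonempty)
    (hd : ∀ x, ∃ V ∈ 𝓝 x, ∀ T ∈ S, Vᶜ ∈ tr T) :
    ∃ Y : OnePointExt X, P Y.carrier ∧ (∀ T ∈ S, Y.le T) ∧
      ∀ W : OnePointExt X, P W.carrier → (∀ T ∈ S, W.le T) → W.le Y := by
  obtain ⟨T0, hT0⟩ := hne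
  have hle : ∀ T ∈ S, tr T ≤ ⨆ T ∈ S, tr T := fun T hT => le_iSup₂ (f := fun T _ => tr T) T hT
  obtain ⟨Y, hPY, hY⟩ := exists_extP hProp hP hnP (G := ⨆ T ∈ S, tr T)
    (((P_iff hProp hP T0).1 (hS T0 hT0)).trans (hle T0 hT0)) (by
      intro x
      obtain ⟨V, hV, hVT⟩ := hd x
      refine Filter.disjoint_iff.2 ⟨V, hV, Vᶜ, ?_, disjoint_compl_right⟩
      simpa only [mem_iSup] using hVT)
  refine ⟨Y, hPY, fun T hT => ?_, fun W _ hW => ?_⟩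
  · rw [le_iff, hY]
    exact (hle T hT).trans (le_core _)
  · rw [le_iff, hY]
    exact (core_mono (iSup₂_le fun T hT => (le_iff _ _).1 (hW T hT))).trans (core_tr W)

lemma compl_mem_of_disj (Y : OnePointExt X) (x : X) : ∃ V ∈ 𝓝 x, Vᶜ ∈ tr Y := by
  obtain ⟨V, hV, W, hW, hd⟩ := Filter.disjoint_iff.1 (tr_disj Y x)
  exact ⟨V, hV, mem_of_superset hW fun y hy hy' => hd.le_bot ⟨hy', hy⟩⟩

lemma compact_compl (Y : OnePointExt X) {K : Set X} (hK : IsCompact K) : Kᶜ ∈ tr Y := by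
  refine hK.compl_mem_sets fun x _ => ?_
  have := tr_disj Y x
  rw [this.eq_bot]
  exact mem_bot

lemma locComp {P : (Z : Type u) → [TopologicalSpace Z] → Prop} (hProp : TopProperty P)
    (hP : Hyp P) [T35Space X] (hloc : LocallyP P X) (hnP : ¬ P X) (S : OnePointExt X)
    (hS : ∀ T : OnePointExt X, P T.carrier → S.le T) : LocallyCompactSpace X := by
  have hw : WeaklyLocallyCompactSpace X := by
    refine ⟨fun x => ?_⟩
    obtain ⟨V, hV, hVS⟩ := compl_mem_of_disj S x
    obtain ⟨K, hK, hKc, hKV⟩ := exists_mem_nhds_isClosed_subset hV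
    refine ⟨K, ?_, hK⟩
    rw [isCompact_iff_ultrafilter_le_nhds']
    intro U hKU
    by_contra hcon
    push Not at hcon
    have hU : ∀ y, ¬ (U : Filter X) ≤ 𝓝 y := by
      intro y hy
      refine hcon y (isClosed_iff_ultrafilter.1 hKc y U hy hKU) hy
    have hUd : ∀ y, Disjoint (𝓝 y) (U : Filter X) := by
      intro y
      rw [disjoint_comm]
      exact Ultrafilter.disjoint_iff_not_le.2 (hU y)
    obtain ⟨T, hPT, hT⟩ := exists_extP hProp hP hnP (G := G0 hProp hP X ⊔ U) le_sup_left
      (fun y => (G0_disj hProp hP hloc y).sup_right (hUd y))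
    have h1 : (U : Filter X) ≤ tr S := by
      refine (le_sup_right.trans (le_core (G0 hProp hP X ⊔ U))).trans ?_
      rw [← hT]
      exact (le_iff _ _).1 (hS T hPT)
    have h2 : Vᶜ ∈ (U : Filter X) := h1 hVS
    have h3 : Vᶜ ∩ K ∈ (U : Filter X) := inter_mem h2 hKU
    obtain ⟨y, hy⟩ := U.neBot.nonempty_of_mem h3
    exact hy.1 (hKV hy.2)
  infer_instance

end
end OPE

/-- Let `X` be a Tychonoff locally-P space not having `P`, where `P` is
either pseudocompactness or a closed hereditary Mrówka topological property preserved under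
finite closed sums of subspaces.  Then `(E_P(X), ≤)` is a lattice (every pair has a least
upper bound and a greatest lower bound) which is also a complete upper semilattice (every
nonempty subset has a least upper bound).  Moreover, `(E_P(X), ≤)` is a complete lattice
(every nonempty subset has a least upper bound and a greatest lower bound) if and only if
`X` is locally compact. -/
theorem stmt19 {X : Type u} [TopologicalSpace X] [T35Space X]
    (P : (Z : Type u) → [TopologicalSpace Z] → Prop) (hProp : TopProperty P)
    (hP : IsPseudocompactness P ∨ (ClosedHereditary P ∧ MrowkaW P ∧ FiniteClosedSums P))
    (hloc : LocallyP P X) (hnP : ¬ P X) :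
    -- pairwise least upper bounds
    (∀ T1 : OnePointExt X, P T1.carrier → ∀ T2 : OnePointExt X, P T2.carrier →
      ∃ S : OnePointExt X, P S.carrier ∧ T1.le S ∧ T2.le S ∧
        ∀ W : OnePointExt X, P W.carrier → T1.le W → T2.le W → S.le W) ∧
    -- pairwise greatest lower bounds
    (∀ T1 : OnePointExt X, P T1.carrier → ∀ T2 : OnePointExt X, P T2.carrier →
      ∃ S : OnePointExt X, P S.carrier ∧ S.le T1 ∧ S.le T2 ∧
        ∀ W : OnePointExt X, P W.carrier → W.le T1 → W.le T2 → W.le S) ∧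
    -- complete upper semilattice: least upper bounds of nonempty subsets
    (∀ 𝒮 : Set (OnePointExt X), 𝒮 ⊆ {T : OnePointExt X | P T.carrier} → 𝒮.Nonempty →
      ∃ S : OnePointExt X, P S.carrier ∧ (∀ T ∈ 𝒮, T.le S) ∧
        ∀ W : OnePointExt X, P W.carrier → (∀ T ∈ 𝒮, T.le W) → S.le W) ∧
    -- complete lattice iff `X` is locally compact
    (((∀ 𝒮 : Set (OnePointExt X), 𝒮 ⊆ {T : OnePointExt X | P T.carrier} → 𝒮.Nonempty →
        ∃ S : OnePointExt X, P S.carrier ∧ (∀ T ∈ 𝒮, T.le S) ∧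
          ∀ W : OnePointExt X, P W.carrier → (∀ T ∈ 𝒮, T.le W) → S.le W) ∧
      (∀ 𝒮 : Set (OnePointExt X), 𝒮 ⊆ {T : OnePointExt X | P T.carrier} → 𝒮.Nonempty →
        ∃ S : OnePointExt X, P S.carrier ∧ (∀ T ∈ 𝒮, S.le T) ∧
          ∀ W : OnePointExt X, P W.carrier → (∀ T ∈ 𝒮, W.le T) → W.le S)) ↔
      LocallyCompactSpace X) := by
  have hsup := OPE.sup_exists hProp hP hnP
  refine ⟨?_, ?_, hsup, ?_, ?_⟩
  · intro T1 h1 T2 h2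
    obtain ⟨S, hS, ha, hb⟩ := hsup {T1, T2} (by rintro T (rfl | rfl) <;> assumption)
      (insert_nonempty _ _)
    refine ⟨S, hS, ha T1 (by simp), ha T2 (by simp), fun W hW hW1 hW2 => hb W hW ?_⟩
    rintro T (rfl | rfl) <;> assumption
  · intro T1 h1 T2 h2
    obtain ⟨S, hS, ha, hb⟩ := OPE.inf_exists hProp hP hnP {T1, T2}
      (by rintro T (rfl | rfl) <;> assumption) (insert_nonempty _ _) (by
        intro x
        obtain ⟨V1, hV1, hT1⟩ := OPE.compl_mem_of_disj T1 x
        obtain ⟨V2, hV2, hT2⟩ := OPE.compl_mem_of_disj T2 x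
        refine ⟨V1 ∩ V2, inter_mem hV1 hV2, ?_⟩
        rintro T (rfl | rfl)
        · exact mem_of_superset hT1 (compl_subset_compl.2 inter_subset_left)
        · exact mem_of_superset hT2 (compl_subset_compl.2 inter_subset_right))
    refine ⟨S, hS, ha T1 (by simp), ha T2 (by simp), fun W hW hW1 hW2 => hb W hW ?_⟩
    rintro T (rfl | rfl) <;> assumption
  · rintro ⟨-, hinf⟩
    obtain ⟨T0, hT0, -⟩ := OPE.exists_extP hProp hP hnP le_rfl (OPE.G0_disj hProp hP hloc)
    obtain ⟨S, -, hS, -⟩ := hinf {T : OnePointExt X | P T.carrier} subset_rfl ⟨T0, hT0⟩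
    exact OPE.locComp hProp hP hloc hnP S hS
  · intro hlc
    refine ⟨hsup, fun S hS hne => OPE.inf_exists hProp hP hnP S hS hne fun x => ?_⟩
    obtain ⟨K, hK, hKx⟩ := exists_compact_mem_nhds x
    exact ⟨K, hKx, fun T _ => OPE.compact_compl T hK⟩
end
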